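/- arXiv:math/0611397 — 9 statements merged into one kernel-verified Lean document; each statement's English description precedes it below -/
import Mathlib

section
/- Let f : K → K be a minimal homeomorphism with no periodic orbits of a compact metric space K, and let A : K → SL(2,ℝ) be continuous. Assume that (f,A) is not uniformly hyperbolic but that there exists an f-invariant Borel probability measure μ with L(f,A,μ) > 0. Then for every ε>0 there exist arbitrarily large N ∈ ℕ (i.e. for every N₀ there is N ≥ N₀) such that for every x ∈ K there exist matrices L_0, …, L_{N−1} ∈ SL(2,ℝ) satisfying ‖L_j − A(f^j(x))‖ < ε for each 0 ≤ j ≤ N−1 and ‖L_{N−1}···L_0‖ < e^{εN}. -/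
open MeasureTheory Filter Topology

instance : TopologicalSpace (Matrix.SpecialLinearGroup (Fin 2) ℝ) :=
  TopologicalSpace.induced (fun M => (M : Matrix (Fin 2) (Fin 2) ℝ)) inferInstance

/-- Operator norm (w.r.t. the euclidean norm on ℝ²) of a 2×2 real matrix. -/
noncomputable def matOpNorm (M : Matrix (Fin 2) (Fin 2) ℝ) : ℝ :=
  ‖Matrix.toEuclideanCLM (𝕜 := ℝ) M‖

noncomputable def sl2Norm (M : Matrix.SpecialLinearGroup (Fin 2) ℝ) : ℝ :=
  matOpNorm (M : Matrix (Fin 2) (Fin 2) ℝ)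

/-- The cocycle iterates: `cocycle f A n x = A(f^{n-1} x) ⋯ A(f x) A(x)`. -/
noncomputable def cocycle {K : Type*} (f : K → K)
    (A : K → Matrix.SpecialLinearGroup (Fin 2) ℝ) :
    ℕ → K → Matrix.SpecialLinearGroup (Fin 2) ℝ
  | 0, _ => 1
  | (n+1), x => cocycle f A n (f x) * A x

/-- The cocycle `(f,A)` is uniformly hyperbolic. -/
def UnifHyp {K : Type*} (f : K → K) (A : K → Matrix.SpecialLinearGroup (Fin 2) ℝ) : Prop :=
  ∃ ε > (0:ℝ), ∃ N : ℕ, ∀ x : K, ∀ n ≥ N, Real.exp (ε * n) ≤ sl2Norm (cocycle f A n x)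

/-- The cocycle `(f,A)` has uniform subexponential growth. -/
def UnifSubexp {K : Type*} (f : K → K) (A : K → Matrix.SpecialLinearGroup (Fin 2) ℝ) : Prop :=
  ∀ ε > (0:ℝ), ∃ N : ℕ, ∀ x : K, ∀ n ≥ N, sl2Norm (cocycle f A n x) ≤ Real.exp (ε * n)

namespace SegmentPerturbation

open Matrix
open scoped MatrixGroups

/-- The square of the euclidean norm on `ℝ²`. -/
def normSq (v : Fin 2 → ℝ) : ℝ := v 0 ^ 2 + v 1 ^ 2

/-- The standard area form on `ℝ²`. -/
def wedge (v w : Fin 2 → ℝ) : ℝ := v 0 * w 1 - v 1 * w 0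

/-- Rotation by a right angle. -/
def rot (v : Fin 2 → ℝ) : Fin 2 → ℝ := ![-v 1, v 0]

lemma normSq_nonneg (v : Fin 2 → ℝ) : 0 ≤ normSq v := by
  unfold normSq; positivity

lemma normSq_pos {v : Fin 2 → ℝ} (hv : v ≠ 0) : 0 < normSq v := by
  refine lt_of_le_of_ne (normSq_nonneg v) fun h => hv ?_
  unfold normSq at h
  ext i
  fin_cases i <;> simp <;> nlinarith [sq_nonneg (v 0), sq_nonneg (v 1)]

lemma normSq_smul (c : ℝ) (v : Fin 2 → ℝ) : normSq (c • v) = c ^ 2 * normSq v := by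
  simp [normSq]; ring

lemma normSq_rot (v : Fin 2 → ℝ) : normSq (rot v) = normSq v := by
  simp [normSq, rot]; ring

lemma wedge_rot (v : Fin 2 → ℝ) : wedge v (rot v) = normSq v := by
  simp [normSq, rot, wedge]; ring

lemma wedge_sq_le (v w : Fin 2 → ℝ) : wedge v w ^ 2 ≤ normSq v * normSq w := by
  simp only [wedge, normSq]
  nlinarith [sq_nonneg (v 0 * w 0 + v 1 * w 1)]

/-- The linear action of `SL(2,ℝ)` on `ℝ²`. -/
def act (M : SL(2, ℝ)) (v : Fin 2 → ℝ) : Fin 2 → ℝ :=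
  (M : Matrix (Fin 2) (Fin 2) ℝ) *ᵥ v

lemma act_one (v : Fin 2 → ℝ) : act 1 v = v := by
  simp [act]

lemma act_mul (M N : SL(2, ℝ)) (v : Fin 2 → ℝ) :
    act (M * N) v = act M (act N v) :=
  (congrArg (· *ᵥ v) (Matrix.SpecialLinearGroup.coe_mul M N)).trans (mulVec_mulVec _ _ _).symm

lemma act_add (M : SL(2, ℝ)) (v w : Fin 2 → ℝ) :
    act M (v + w) = act M v + act M w := mulVec_add _ _ _

lemma act_smul (M : SL(2, ℝ)) (c : ℝ) (v : Fin 2 → ℝ) :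
    act M (c • v) = c • act M v := mulVec_smul _ _ _

lemma wedge_act (M : SL(2, ℝ)) (v w : Fin 2 → ℝ) :
    wedge (act M v) (act M w) = wedge v w := by
  have h := M.det_coe
  rw [det_fin_two] at h
  simp only [act, wedge, mulVec, dotProduct, Fin.sum_univ_two]
  linear_combination (v 0 * w 1 - v 1 * w 0) * h

lemma exists_eq_smul_of_wedge_eq_zero {u v : Fin 2 → ℝ} (hv : v ≠ 0) (h : wedge u v = 0) :
    ∃ c : ℝ, u = c • v := by
  have hq := normSq_pos hv
  refine ⟨(u 0 * v 0 + u 1 * v 1) / normSq v, ?_⟩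
  unfold wedge at h
  ext i
  fin_cases i <;> simp <;> field_simp <;> simp only [normSq]
  · linear_combination v 1 * h
  · linear_combination -v 0 * h

lemma normSq_eq_norm_sq (v : EuclideanSpace ℝ (Fin 2)) : normSq v.ofLp = ‖v‖ ^ 2 := by
  simp [EuclideanSpace.norm_sq_eq, normSq]

lemma toEuclideanCLM_ofLp (M : Matrix (Fin 2) (Fin 2) ℝ) (v : EuclideanSpace ℝ (Fin 2)) :
    (toEuclideanCLM (𝕜 := ℝ) M v).ofLp = M *ᵥ v.ofLp := by
  simp

lemma matOpNorm_nonneg (M : Matrix (Fin 2) (Fin 2) ℝ) : 0 ≤ matOpNorm M := norm_nonneg _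

lemma normSq_mulVec_le (M : Matrix (Fin 2) (Fin 2) ℝ) (v : Fin 2 → ℝ) :
    normSq (M *ᵥ v) ≤ matOpNorm M ^ 2 * normSq v := by
  have h := (toEuclideanCLM (𝕜 := ℝ) M).le_opNorm (WithLp.toLp 2 v)
  have h2 := pow_le_pow_left₀ (norm_nonneg _) h 2
  rw [mul_pow, ← normSq_eq_norm_sq, ← normSq_eq_norm_sq, toEuclideanCLM_ofLp] at h2
  exact h2

lemma matOpNorm_le {M : Matrix (Fin 2) (Fin 2) ℝ} {c : ℝ} (hc : 0 ≤ c)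
    (h : ∀ v, normSq (M *ᵥ v) ≤ c ^ 2 * normSq v) : matOpNorm M ≤ c := by
  refine ContinuousLinearMap.opNorm_le_bound _ hc fun v => ?_
  refine le_of_sq_le_sq ?_ (by positivity)
  rw [mul_pow, ← normSq_eq_norm_sq, ← normSq_eq_norm_sq, toEuclideanCLM_ofLp]
  exact h _

lemma matOpNorm_mul_le (M N : Matrix (Fin 2) (Fin 2) ℝ) :
    matOpNorm (M * N) ≤ matOpNorm M * matOpNorm N := by
  unfold matOpNorm
  rw [map_mul]
  exact norm_mul_le _ _

lemma matOpNorm_add_le (M N : Matrix (Fin 2) (Fin 2) ℝ) :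
    matOpNorm (M + N) ≤ matOpNorm M + matOpNorm N := by
  unfold matOpNorm
  rw [map_add]
  exact norm_add_le _ _

lemma matOpNorm_zero : matOpNorm 0 = 0 := by
  simp [matOpNorm]

lemma continuous_matOpNorm : Continuous matOpNorm :=
  continuous_norm.comp (LinearMap.continuous_of_finiteDimensional
    (toEuclideanCLM (n := Fin 2) (𝕜 := ℝ)).toAlgEquiv.toLinearMap)

/-- The matrix norm is attained on the unit circle. -/
lemma exists_normSq_mulVec_eq (M : Matrix (Fin 2) (Fin 2) ℝ) :
    ∃ a : Fin 2 → ℝ, normSq a = 1 ∧ normSq (M *ᵥ a) = matOpNorm M ^ 2 := by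
  have hc : IsCompact (Metric.sphere (0 : EuclideanSpace ℝ (Fin 2)) 1) := isCompact_sphere _ _
  have hne : (Metric.sphere (0 : EuclideanSpace ℝ (Fin 2)) 1).Nonempty :=
    NormedSpace.sphere_nonempty.2 zero_le_one
  obtain ⟨a, ha, hmax⟩ := hc.exists_isMaxOn hne
    (f := fun v => ‖toEuclideanCLM (𝕜 := ℝ) M v‖) (by fun_prop)
  have ha1 : ‖a‖ = 1 := by simpa using ha
  refine ⟨a.ofLp, by rw [normSq_eq_norm_sq, ha1, one_pow], ?_⟩
  rw [← toEuclideanCLM_ofLp, normSq_eq_norm_sq]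
  congr 1
  refine le_antisymm ?_ ?_
  · simpa [ha1, matOpNorm] using (toEuclideanCLM (𝕜 := ℝ) M).le_opNorm a
  · refine ContinuousLinearMap.opNorm_le_of_unit_norm (𝕜 := ℝ) (norm_nonneg _) fun v hv => ?_
    exact hmax (by simpa using hv)

lemma sl2Norm_nonneg (M : SL(2, ℝ)) : 0 ≤ sl2Norm M := matOpNorm_nonneg _

lemma normSq_act_le (M : SL(2, ℝ)) (v : Fin 2 → ℝ) :
    normSq (act M v) ≤ sl2Norm M ^ 2 * normSq v := normSq_mulVec_le _ v

lemma sl2Norm_le {M : SL(2, ℝ)} {c : ℝ} (hc : 0 ≤ c)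
    (h : ∀ v, normSq (act M v) ≤ c ^ 2 * normSq v) : sl2Norm M ≤ c := matOpNorm_le hc h

lemma sl2Norm_mul_le (M N : SL(2, ℝ)) :
    sl2Norm (M * N) ≤ sl2Norm M * sl2Norm N :=
  (congrArg matOpNorm (Matrix.SpecialLinearGroup.coe_mul M N)).trans_le (matOpNorm_mul_le _ _)

lemma one_le_sl2Norm (M : SL(2, ℝ)) : 1 ≤ sl2Norm M := by
  have h1 := wedge_act M ![1, 0] ![0, 1]
  have h2 := wedge_sq_le (act M ![1, 0]) (act M ![0, 1])
  have h3 := normSq_act_le M ![1, 0]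
  have h4 := normSq_act_le M ![0, 1]
  have e1 : normSq ![1, 0] = 1 := by simp [normSq]
  have e2 : normSq ![0, 1] = 1 := by simp [normSq]
  have e3 : wedge ![1, 0] ![0, 1] = 1 := by simp [wedge]
  rw [h1, e3] at h2
  rw [e1] at h3
  rw [e2] at h4
  have h5 := mul_le_mul h3 h4 (normSq_nonneg _) (by positivity)
  have h6 : (1 : ℝ) ≤ sl2Norm M ^ 4 := by linarith
  exact (one_le_pow_iff_of_nonneg (sl2Norm_nonneg M) (by norm_num)).1 h6

lemma sl2Norm_one : sl2Norm 1 = 1 := by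
  refine le_antisymm (sl2Norm_le zero_le_one fun v => ?_) (one_le_sl2Norm 1)
  simp [act_one]

lemma normSq_le_mul_normSq_act (M : SL(2, ℝ)) (v : Fin 2 → ℝ) :
    normSq v ≤ sl2Norm M ^ 2 * normSq (act M v) := by
  rcases eq_or_ne v 0 with rfl | hv
  · simpa [normSq] using mul_nonneg (sq_nonneg (sl2Norm M)) (normSq_nonneg (act M 0))
  have hq := normSq_pos hv
  have h1 := wedge_sq_le (act M v) (act M (rot v))
  rw [wedge_act, wedge_rot] at h1
  have h2 := normSq_act_le M (rot v)
  rw [normSq_rot] at h2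
  have h3 := mul_le_mul_of_nonneg_left h2 (normSq_nonneg (act M v))
  refine le_of_mul_le_mul_right ?_ hq
  calc normSq v * normSq v ≤ _ := by nlinarith
    _ ≤ _ := h3
    _ = _ := by ring

lemma sl2Norm_inv_le (M : SL(2, ℝ)) : sl2Norm M⁻¹ ≤ sl2Norm M := by
  refine sl2Norm_le (sl2Norm_nonneg M) fun v => ?_
  have h := normSq_le_mul_normSq_act M (act M⁻¹ v)
  rwa [← act_mul, mul_inv_cancel, act_one] at h

lemma sl2Norm_le_mul_left (M N : SL(2, ℝ)) :
    sl2Norm N ≤ sl2Norm M * sl2Norm (M * N) := by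
  calc sl2Norm N = sl2Norm (M⁻¹ * (M * N)) := by rw [inv_mul_cancel_left]
    _ ≤ sl2Norm M⁻¹ * sl2Norm (M * N) := sl2Norm_mul_le _ _
    _ ≤ _ := mul_le_mul_of_nonneg_right (sl2Norm_inv_le M) (sl2Norm_nonneg _)

lemma sl2Norm_le_mul_right (M N : SL(2, ℝ)) :
    sl2Norm M ≤ sl2Norm (M * N) * sl2Norm N := by
  calc sl2Norm M = sl2Norm ((M * N) * N⁻¹) := by rw [mul_inv_cancel_right]
    _ ≤ sl2Norm (M * N) * sl2Norm N⁻¹ := sl2Norm_mul_le _ _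
    _ ≤ _ := mul_le_mul_of_nonneg_left (sl2Norm_inv_le N) (sl2Norm_nonneg _)

/-- Singular directions of a matrix of determinant one. -/
lemma exists_singular_direction (M : SL(2, ℝ)) :
    ∃ a : Fin 2 → ℝ, normSq a = 1 ∧ normSq (act M a) = sl2Norm M ^ 2 ∧
      sl2Norm M ^ 2 * normSq (act M (rot a)) = 1 := by
  obtain ⟨a, ha, hM⟩ := exists_normSq_mulVec_eq (M : Matrix (Fin 2) (Fin 2) ℝ)
  refine ⟨a, ha, hM, ?_⟩
  change normSq (act M a) = sl2Norm M ^ 2 at hM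
  have hw : wedge (act M a) (act M (rot a)) = 1 := by rw [wedge_act, wedge_rot, ha]
  set x := act M a with hx
  set y := act M (rot a) with hy
  have key : ∀ s : ℝ, 2 * s * (x 0 * y 0 + x 1 * y 1) + s ^ 2 * (normSq y - sl2Norm M ^ 2) ≤ 0 := by
    intro s
    have h := normSq_act_le M (a + s • rot a)
    rw [act_add, act_smul, ← hx, ← hy] at h
    have e : normSq (a + s • rot a) = 1 + s ^ 2 := by
      rw [show normSq (a + s • rot a) = (1 + s ^ 2) * normSq a by
        simp [normSq, rot]; ring, ha, mul_one]
    rw [e] at h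
    have e2 : normSq (x + s • y) = normSq x + 2 * s * (x 0 * y 0 + x 1 * y 1)
        + s ^ 2 * normSq y := by
      simp [normSq]; ring
    rw [e2, hM] at h
    linarith
  have horth : x 0 * y 0 + x 1 * y 1 = 0 := by
    set m := x 0 * y 0 + x 1 * y 1
    set d := normSq y - sl2Norm M ^ 2
    by_contra hm
    have h1 := key (m / (1 + |d|))
    have hd : 0 < 1 + |d| := by positivity
    have hm2 : 0 < m ^ 2 := by positivity
    have h2 : 2 * m ^ 2 * (1 + |d|) + m ^ 2 * d ≤ 0 := by
      have : 2 * (m / (1 + |d|)) * m + (m / (1 + |d|)) ^ 2 * d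
          = (2 * m ^ 2 * (1 + |d|) + m ^ 2 * d) / (1 + |d|) ^ 2 := by
        field_simp
      rw [this] at h1
      by_contra! hcon
      exact absurd h1 (not_le.2 (by positivity))
    nlinarith [neg_abs_le d, abs_nonneg d, mul_nonneg hm2.le (abs_nonneg d),
      mul_le_mul_of_nonneg_left (neg_abs_le d) hm2.le]
  rw [← hM]
  have : normSq x * normSq y = wedge x y ^ 2 + (x 0 * y 0 + x 1 * y 1) ^ 2 := by
    simp only [normSq, wedge]; ring
  rw [this, hw, horth]; norm_num

lemma dot_sq_le (v w : Fin 2 → ℝ) :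
    (v 0 * w 0 + v 1 * w 1) ^ 2 ≤ normSq v * normSq w := by
  simp only [normSq]
  nlinarith [sq_nonneg (v 0 * w 1 - v 1 * w 0)]

/-- The norm is controlled by the images of an orthonormal basis. -/
lemma sl2Norm_le_add {N : SL(2, ℝ)} {a : Fin 2 → ℝ} {r s : ℝ} (ha : normSq a = 1)
    (hr0 : 0 ≤ r) (hs0 : 0 ≤ s) (h1 : normSq (act N a) ≤ r ^ 2)
    (h2 : normSq (act N (rot a)) ≤ s ^ 2) : sl2Norm N ≤ r + s := by
  refine sl2Norm_le (by positivity) fun z => ?_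
  set ξ := z 0 * a 0 + z 1 * a 1 with hξ
  set η := -z 0 * a 1 + z 1 * a 0 with hη
  have hz : z = ξ • a + η • rot a := by
    have ha' : a 0 ^ 2 + a 1 ^ 2 = 1 := ha
    ext i
    fin_cases i <;> simp [rot, hξ, hη]
    · linear_combination -z 0 * ha'
    · linear_combination -z 1 * ha'
  have hnz : normSq z = ξ ^ 2 + η ^ 2 := by
    rw [show ξ ^ 2 + η ^ 2 = normSq z * normSq a by simp only [hξ, hη, normSq]; ring, ha, mul_one]
  rw [hnz, show act N z = _ from congrArg _ hz, act_add, act_smul, act_smul]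
  clear_value ξ η
  set p := act N a
  set q := act N (rot a)
  have hpq : (p 0 * q 0 + p 1 * q 1) ^ 2 ≤ (r * s) ^ 2 := by
    rw [mul_pow]
    exact (dot_sq_le p q).trans (mul_le_mul h1 h2 (normSq_nonneg _) (by positivity))
  have habs := abs_le_of_sq_le_sq hpq (by positivity)
  have e : normSq (ξ • p + η • q) = ξ ^ 2 * normSq p + 2 * (ξ * η) * (p 0 * q 0 + p 1 * q 1)
      + η ^ 2 * normSq q := by
    simp [normSq]; ring
  rw [e]
  have i1 := mul_le_mul_of_nonneg_left h1 (sq_nonneg ξ)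
  have i2 := mul_le_mul_of_nonneg_left h2 (sq_nonneg η)
  have i3 : 2 * (ξ * η) * (p 0 * q 0 + p 1 * q 1) ≤ (ξ ^ 2 + η ^ 2) * (r * s) := by
    have i4 : 2 * (ξ * η) * (p 0 * q 0 + p 1 * q 1)
        ≤ |2 * (ξ * η)| * |p 0 * q 0 + p 1 * q 1| := by
      rw [← abs_mul]; exact le_abs_self _
    refine i4.trans (mul_le_mul ?_ habs (abs_nonneg _) (by positivity))
    rw [abs_le]
    constructor <;> nlinarith [sq_nonneg (ξ - η), sq_nonneg (ξ + η)]
  have i5 : 0 ≤ (ξ ^ 2 + η ^ 2) * (r * s) := by positivity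
  have i6 : 0 ≤ ξ ^ 2 * s ^ 2 := by positivity
  have i7 : 0 ≤ η ^ 2 * r ^ 2 := by positivity
  nlinarith

/-- If `Q` sends the most expanded direction of `X` to the most contracted direction of `Y`,
then the growth of `Y * Q * X` is controlled by the ratio of the norms of `X` and `Y`. -/
lemma exists_directions_sl2Norm_mul_le (X Y : SL(2, ℝ)) :
    ∃ u v : Fin 2 → ℝ, u ≠ 0 ∧ v ≠ 0 ∧ ∀ Q : SL(2, ℝ),
      (∃ c : ℝ, act Q u = c • v) →
        sl2Norm (Y * Q * X) ≤ sl2Norm Q * (sl2Norm X / sl2Norm Y + sl2Norm Y / sl2Norm X) := by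
  obtain ⟨a, ha, hXa, hXr⟩ := exists_singular_direction X
  obtain ⟨b, hb, -, hYr⟩ := exists_singular_direction Y
  have hX := one_le_sl2Norm X
  have hY := one_le_sl2Norm Y
  have hQ0 := fun Q => sl2Norm_nonneg Q
  refine ⟨act X a, rot b, ?_, ?_, ?_⟩
  · intro h
    rw [h] at hXa
    have : normSq 0 = 0 := by simp [normSq]
    rw [this] at hXa
    nlinarith
  · intro h
    have := normSq_rot b
    rw [h, hb] at this
    simp [normSq] at this
  rintro Q ⟨c, hc⟩
  set α := sl2Norm X
  set β := sl2Norm Y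
  set κ := sl2Norm Q
  have hκ : 0 ≤ κ := hQ0 Q
  have hα : 0 < α := by linarith
  have hβ : 0 < β := by linarith
  have h1 : normSq (act (Y * Q * X) a) ≤ (κ * (α / β)) ^ 2 := by
    have e : act (Y * Q * X) a = c • (act Y (rot b)) := by
      rw [act_mul, act_mul, hc, act_smul]
    have hcq : c ^ 2 ≤ κ ^ 2 * α ^ 2 := by
      have := normSq_act_le Q (act X a)
      rw [hc, normSq_smul, normSq_rot, hb, hXa] at this
      linarith
    rw [e, normSq_smul, mul_pow, div_pow]
    have e2 : normSq (act Y (rot b)) = 1 / β ^ 2 := by field_simp; linarith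
    rw [e2, mul_one_div, ← mul_div_assoc]
    gcongr
  have h2 : normSq (act (Y * Q * X) (rot a)) ≤ (κ * (β / α)) ^ 2 := by
    rw [act_mul]
    have e2 : normSq (act X (rot a)) = 1 / α ^ 2 := by field_simp; linarith
    refine (normSq_act_le _ _).trans ?_
    rw [e2]
    have := pow_le_pow_left₀ (sl2Norm_nonneg _) (sl2Norm_mul_le Y Q) 2
    calc sl2Norm (Y * Q) ^ 2 * (1 / α ^ 2) ≤ (β * κ) ^ 2 * (1 / α ^ 2) := by gcongr
      _ = _ := by ring
  set r := κ * (α / β) with hr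
  set s := κ * (β / α) with hs
  have hr0 : 0 ≤ r := by positivity
  have hs0 : 0 ≤ s := by positivity
  have : κ * (α / β + β / α) = r + s := by rw [hr, hs]; ring
  rw [this]
  exact sl2Norm_le_add ha hr0 hs0 h1 h2

/-- The ordered product `M (n-1) * ⋯ * M 1 * M 0`. -/
noncomputable def orderedProd (M : ℕ → SL(2, ℝ)) : ℕ → SL(2, ℝ)
  | 0 => 1
  | n + 1 => M n * orderedProd M n

lemma orderedProd_congr {M N : ℕ → SL(2, ℝ)} {n : ℕ} (h : ∀ j < n, M j = N j) :
    orderedProd M n = orderedProd N n := by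
  induction n with
  | zero => rfl
  | succ n ih =>
    simp only [orderedProd]
    rw [h n n.lt_succ_self, ih fun j hj => h j (hj.trans n.lt_succ_self)]

lemma orderedProd_add (M : ℕ → SL(2, ℝ)) (a b : ℕ) :
    orderedProd M (a + b) = orderedProd (fun j => M (a + j)) b * orderedProd M a := by
  induction b with
  | zero => simp [orderedProd]
  | succ b ih => rw [← add_assoc, orderedProd, ih, orderedProd, mul_assoc]

lemma prod_reverse_ofFn (M : ℕ → SL(2, ℝ)) (n : ℕ) :
    (List.ofFn fun i : Fin n => M i).reverse.prod = orderedProd M n := by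
  induction n with
  | zero => simp [orderedProd]
  | succ n ih =>
    rw [List.ofFn_succ', List.concat_eq_append, List.reverse_append]
    simpa [orderedProd] using ih

lemma cocycle_eq_orderedProd {K : Type*} (f : K → K) (A : K → SL(2, ℝ)) (n : ℕ) (x : K) :
    cocycle f A n x = orderedProd (fun j => A (f^[j] x)) n := by
  induction n generalizing x with
  | zero => rfl
  | succ n ih =>
    rw [cocycle, ih, add_comm n 1, orderedProd_add]
    simp [orderedProd, add_comm 1]

lemma sl2Norm_orderedProd_le {M : ℕ → SL(2, ℝ)} {C : ℝ} {n : ℕ}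
    (h : ∀ j < n, sl2Norm (M j) ≤ C) : sl2Norm (orderedProd M n) ≤ C ^ n := by
  induction n with
  | zero => simp [orderedProd, sl2Norm_one]
  | succ n ih =>
    rw [orderedProd, pow_succ']
    have h1 := h n n.lt_succ_self
    exact (sl2Norm_mul_le _ _).trans (mul_le_mul h1
      (ih fun j hj => h j (hj.trans n.lt_succ_self)) (sl2Norm_nonneg _)
      ((sl2Norm_nonneg _).trans h1))

/-- The shear `v ↦ v + a (v ∧ p) p`. -/
def transvection (a : ℝ) (p : Fin 2 → ℝ) : SL(2, ℝ) :=
  ⟨!![1 + a * (p 0 * p 1), -(a * p 0 ^ 2); a * p 1 ^ 2, 1 - a * (p 0 * p 1)], by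
    rw [det_fin_two_of]; ring⟩

lemma act_transvection (a : ℝ) (p v : Fin 2 → ℝ) :
    act (transvection a p) v = v + (a * wedge v p) • p := by
  ext i
  fin_cases i <;> simp [act, transvection, wedge, mulVec, dotProduct, Fin.sum_univ_two] <;> ring

/-- The distance from `T` to the identity. -/
noncomputable def distOne (T : SL(2, ℝ)) : ℝ :=
  matOpNorm ((T : Matrix (Fin 2) (Fin 2) ℝ) - 1)

lemma distOne_one : distOne 1 = 0 := by
  simp [distOne, matOpNorm_zero]

lemma distOne_transvection_le {a η : ℝ} {p : Fin 2 → ℝ} (h : |a| * normSq p ≤ η) :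
    distOne (transvection a p) ≤ η := by
  have h0 : 0 ≤ |a| * normSq p := mul_nonneg (abs_nonneg a) (normSq_nonneg p)
  refine le_trans (matOpNorm_le h0 fun v => ?_) h
  have e : ((transvection a p : SL(2, ℝ)) - 1 : Matrix (Fin 2) (Fin 2) ℝ) *ᵥ v
      = (a * wedge v p) • p := by
    rw [sub_mulVec, one_mulVec, sub_eq_iff_eq_add, add_comm]
    exact act_transvection a p v
  rw [e, normSq_smul, mul_pow, mul_pow, sq_abs]
  have := mul_le_mul_of_nonneg_left (wedge_sq_le v p)
    (mul_nonneg (sq_nonneg a) (normSq_nonneg p))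
  nlinarith

/-- A vector can be sent onto a line at small angle by a shear close to the identity. -/
lemma exists_act_eq_smul_of_small_angle {u w : Fin 2 → ℝ} {δ : ℝ} (hδ : 0 < δ)
    (hw : wedge u w = 1) (h : 1 ≤ δ ^ 2 * (normSq u * normSq w)) :
    ∃ T : SL(2, ℝ), distOne T ≤ 2 * δ ∧ ∃ c : ℝ, act T u = c • w := by
  have hu0 : u ≠ 0 := by rintro rfl; simp [wedge] at hw
  have hw0 : w ≠ 0 := by rintro rfl; simp [wedge] at hw
  have hqu := normSq_pos hu0
  have hqw := normSq_pos hw0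
  -- `c • w` is the vector on the line of `w` with the norm of `u` on the side of `u`
  obtain ⟨c, hc2, hcd⟩ : ∃ c : ℝ, c ^ 2 * normSq w = normSq u ∧
      0 ≤ c * (u 0 * w 0 + u 1 * w 1) := by
    have hs : Real.sqrt (normSq u / normSq w) ^ 2 * normSq w = normSq u := by
      rw [Real.sq_sqrt (by positivity)]; field_simp
    rcases le_total 0 (u 0 * w 0 + u 1 * w 1) with hd | hd
    · exact ⟨_, hs, mul_nonneg (Real.sqrt_nonneg _) hd⟩
    · exact ⟨-Real.sqrt (normSq u / normSq w), by rw [neg_sq, hs],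
        mul_nonneg_of_nonpos_of_nonpos (neg_nonpos.2 (Real.sqrt_nonneg _)) hd⟩
  have hc0 : c ≠ 0 := by rintro rfl; simp at hc2; linarith
  have hcpos : 0 < |c| := abs_pos.2 hc0
  refine ⟨transvection c⁻¹ (c • w - u), distOne_transvection_le ?_, c, ?_⟩
  · set d := u 0 * w 0 + u 1 * w 1 with hd
    have hp : normSq (c • w - u) = 2 * (normSq u - c * d) := by
      have : normSq (c • w - u) = c ^ 2 * normSq w - 2 * (c * d) + normSq u := by
        simp [normSq, hd]; ring
      rw [this, hc2]; ring
    have hlag : normSq u * normSq w = d ^ 2 + 1 := by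
      rw [show normSq u * normSq w = d ^ 2 + wedge u w ^ 2 by
        simp only [normSq, wedge, hd]; ring, hw]; ring
    have h1 : normSq u * (normSq u - c * d) ≤ c ^ 2 := by
      have e : normSq u ^ 2 = (c * d) ^ 2 + c ^ 2 := by
        calc normSq u ^ 2 = c ^ 2 * (normSq u * normSq w) := by rw [sq]; nth_rw 2 [← hc2]; ring
          _ = _ := by rw [hlag]; ring
      have hle : c * d ≤ normSq u := abs_le_of_sq_le_sq' (by nlinarith) hqu.le |>.2
      nlinarith
    have h2 : |c| ≤ δ * normSq u := by
      refine abs_le_of_sq_le_sq ?_ (by positivity)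
      have : δ ^ 2 * (normSq u * normSq w) * c ^ 2 = (δ * normSq u) ^ 2 := by
        rw [show δ ^ 2 * (normSq u * normSq w) * c ^ 2 = δ ^ 2 * normSq u * (c ^ 2 * normSq w) by
          ring, hc2]; ring
      nlinarith [sq_nonneg c]
    rw [hp, abs_inv, inv_mul_le_iff₀ hcpos]
    refine le_of_mul_le_mul_left ?_ hqu
    have h3 : c ^ 2 ≤ |c| * (δ * normSq u) := by
      rw [← sq_abs, sq]; exact mul_le_mul_of_nonneg_left h2 hcpos.le
    nlinarith
  · rw [act_transvection]
    have : wedge u (c • w - u) = c * wedge u w := by simp [wedge]; ring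
    rw [this, hw, mul_one, inv_mul_cancel₀ hc0, one_smul, add_sub_cancel]

/-- `x` is the image of `u` under a product of `n` perturbations of the matrices `M j`,
of relative size `η`. -/
def Reach (M : ℕ → SL(2, ℝ)) (η : ℝ) (u : Fin 2 → ℝ) (n : ℕ) (x : Fin 2 → ℝ) : Prop :=
  ∃ T : ℕ → SL(2, ℝ), (∀ j, distOne (T j) ≤ η) ∧ act (orderedProd (fun j => M j * T j) n) u = x

namespace Reach

variable {M : ℕ → SL(2, ℝ)} {η : ℝ} {u x : Fin 2 → ℝ} {n : ℕ}

lemma zero (hη : 0 ≤ η) : Reach M η u 0 u :=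
  ⟨fun _ => 1, fun _ => distOne_one.trans_le hη, act_one u⟩

lemma succ (h : Reach M η u n x) {S : SL(2, ℝ)} (hS : distOne S ≤ η) :
    Reach M η u (n + 1) (act (M n) (act S x)) := by
  obtain ⟨T, hT, rfl⟩ := h
  refine ⟨Function.update T n S, fun j => ?_, ?_⟩
  · rcases eq_or_ne j n with rfl | hj
    · simpa using hS
    · simpa [hj] using hT j
  · rw [orderedProd, orderedProd_congr (N := fun j => M j * T j) fun j hj => by simp [hj.ne]]
    simp [act_mul]

lemma succ_one (h : Reach M η u n x) (hη : 0 ≤ η) : Reach M η u (n + 1) (act (M n) x) := by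
  simpa [act_one] using h.succ (distOne_one.trans_le hη)

end Reach

/-- The orbit of a vector under the partial products. -/
lemma act_orderedProd_succ (M : ℕ → SL(2, ℝ)) (n : ℕ) (v : Fin 2 → ℝ) :
    act (orderedProd M (n + 1)) v = act (M n) (act (orderedProd M n) v) :=
  act_mul _ _ _

lemma reach_orbit (M : ℕ → SL(2, ℝ)) {η : ℝ} (hη : 0 ≤ η) (u : Fin 2 → ℝ) (n : ℕ) :
    Reach M η u n (act (orderedProd M n) u) := by
  induction n with
  | zero => simpa [orderedProd, act_one] using Reach.zero hη
  | succ n ih => rw [act_orderedProd_succ]; exact ih.succ_one hη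

/-- Once the line of `w` is reached, one may follow its orbit. -/
lemma Reach.follow {M : ℕ → SL(2, ℝ)} {η : ℝ} {u w : Fin 2 → ℝ} {k : ℕ} {c : ℝ} (hη : 0 ≤ η)
    (h : Reach M η u k (c • act (orderedProd M k) w)) {n : ℕ} (hn : k ≤ n) :
    Reach M η u n (c • act (orderedProd M n) w) := by
  induction n, hn using Nat.le_induction with
  | base => exact h
  | succ n _ ih => rw [act_orderedProd_succ, ← act_smul]; exact ih.succ_one hη

lemma reach_add_smul (M : ℕ → SL(2, ℝ)) {δ : ℝ} (hδ : 0 < δ) {u w : Fin 2 → ℝ}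
    (hw : wedge u w = 1) (k : ℕ) :
    Reach M (2 * δ) u k (act (orderedProd M k) u +
      (δ * ∑ j ∈ Finset.range k, (normSq (act (orderedProd M j) w))⁻¹) •
        act (orderedProd M k) w) := by
  induction k with
  | zero => simpa [orderedProd, act_one] using Reach.zero (by positivity)
  | succ k ih =>
    set uk := act (orderedProd M k) u with huk
    set wk := act (orderedProd M k) w with hwk
    have hwedge : wedge uk wk = 1 := by rw [huk, hwk, wedge_act, hw]
    have hwk0 : wk ≠ 0 := by intro h; rw [h] at hwedge; simp [wedge] at hwedge
    have hq := normSq_pos hwk0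
    have hd : distOne (transvection (δ * (normSq wk)⁻¹) wk) ≤ 2 * δ := by
      apply distOne_transvection_le
      rw [abs_of_pos (by positivity), mul_assoc, inv_mul_cancel₀ hq.ne']
      linarith
    convert ih.succ hd using 1
    rw [act_transvection, act_orderedProd_succ, act_orderedProd_succ, ← huk, ← hwk, ← act_smul,
      ← act_add, Finset.sum_range_succ]
    congr 1
    set σ := ∑ j ∈ Finset.range k, (normSq (act (orderedProd M j) w))⁻¹
    have : wedge (uk + (δ * σ) • wk) wk = wedge uk wk := by simp [wedge]; ring
    rw [this, hwedge, ← hwk]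
    module

/-- Along a segment where the products do not grow fast, every direction can be moved to every
other direction by perturbations. -/
lemma reach_of_slow_growth (M : ℕ → SL(2, ℝ)) {δ : ℝ} (hδ : 0 < δ) {m : ℕ}
    (hslow : sl2Norm (orderedProd M (m + 1)) ^ 2 < δ ^ 4 * (1 + δ ^ 4) ^ m)
    (u : Fin 2 → ℝ) {v : Fin 2 → ℝ} (hv : v ≠ 0) :
    ∃ c : ℝ, Reach M (2 * δ) u (m + 2) (c • v) := by
  have hη : 0 ≤ 2 * δ := by positivity
  set n := m + 2 with hn
  set z := act (orderedProd M n)⁻¹ v with hz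
  have hPz : act (orderedProd M n) z = v := by rw [hz, ← act_mul, mul_inv_cancel, act_one]
  have hz0 : z ≠ 0 := by
    intro h
    rw [h] at hPz
    exact hv (by rw [← hPz]; simp [act])
  by_cases huz : wedge u z = 0
  · obtain ⟨c, hc⟩ := exists_eq_smul_of_wedge_eq_zero hz0 huz
    refine ⟨c, ?_⟩
    rw [← hPz, ← act_smul, ← hc]
    exact reach_orbit M hη u n
  set w := (wedge u z)⁻¹ • z with hwdef
  have hw : wedge u w = 1 := by
    have : wedge u w = (wedge u z)⁻¹ * wedge u z := by
      generalize (wedge u z)⁻¹ = c at hwdef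
      rw [hwdef]; simp [wedge]; ring
    rw [this, inv_mul_cancel₀ huz]
  suffices h : ∃ c : ℝ, Reach M (2 * δ) u n (c • act (orderedProd M n) w) by
    obtain ⟨c, hc⟩ := h
    refine ⟨c * (wedge u z)⁻¹, ?_⟩
    rwa [hwdef, act_smul, hPz, smul_smul] at hc
  by_contra! hno
  have hwedge : ∀ j, wedge (act (orderedProd M j) u) (act (orderedProd M j) w) = 1 := fun j => by
    rw [wedge_act, hw]
  set a : ℕ → ℝ := fun j => (normSq (act (orderedProd M j) w))⁻¹ with ha
  set b : ℕ → ℝ := fun j => (normSq (act (orderedProd M j) u))⁻¹ with hb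
  have hwpos : ∀ j, 0 < normSq (act (orderedProd M j) w) := fun j => normSq_pos fun h => by
    have := hwedge j; rw [h] at this; simp [wedge] at this
  have hupos : ∀ j, 0 < normSq (act (orderedProd M j) u) := fun j => normSq_pos fun h => by
    have := hwedge j; rw [h] at this; simp [wedge] at this
  have hapos : ∀ j, 0 < a j := fun j => inv_pos.2 (hwpos j)
  have hbpos : ∀ j, 0 < b j := fun j => inv_pos.2 (hupos j)
  have hangle : ∀ j < n, δ ^ 2 ≤ a j * b j := by
    intro j hj
    by_contra! hcon
    have h1 : 1 ≤ δ ^ 2 * (normSq (act (orderedProd M j) u) *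
        normSq (act (orderedProd M j) w)) := by
      have e : a j * b j * (normSq (act (orderedProd M j) u) *
          normSq (act (orderedProd M j) w)) = 1 := by
        have := (hwpos j).ne'
        have := (hupos j).ne'
        simp only [ha, hb]
        field_simp
      rw [← e]
      exact mul_le_mul_of_nonneg_right hcon.le (mul_pos (hupos j) (hwpos j)).le
    obtain ⟨S, hS, c, hc⟩ := exists_act_eq_smul_of_small_angle hδ (hwedge j) h1
    have h2 := (reach_orbit M hη u j).succ hS
    rw [hc, act_smul, ← act_orderedProd_succ] at h2
    exact hno c (h2.follow hη hj)
  have hprod : ∀ k < n, (∑ j ∈ Finset.range k, a j) * b k * δ ^ 2 ≤ 1 := by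
    intro k hk
    by_contra! hcon
    set s := ∑ j ∈ Finset.range k, a j with hs
    have hs0 : 0 < s := by
      have : 0 < s * (b k * δ ^ 2) := by linarith
      exact pos_of_mul_pos_left this (mul_pos (hbpos k) (by positivity)).le
    set uk := act (orderedProd M k) u with huk
    set wk := act (orderedProd M k) w with hwk
    have hσ : 0 < δ * s := by positivity
    have hS : distOne (transvection (δ * s)⁻¹ uk) ≤ 2 * δ := by
      apply distOne_transvection_le
      rw [abs_of_pos (inv_pos.2 hσ), inv_mul_le_iff₀ hσ]
      have h1 : normSq uk * (s * b k * δ ^ 2) = s * δ ^ 2 := by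
        have : normSq uk * b k = 1 := mul_inv_cancel₀ (hupos k).ne'
        linear_combination s * δ ^ 2 * this
      have h2 : 0 < s * δ ^ 2 := by positivity
      nlinarith [hupos k]
    have h1 := (reach_add_smul M hδ hw k).succ hS
    have e : act (transvection (δ * s)⁻¹ uk) (uk + (δ * s) • wk) = (δ * s) • wk := by
      have : wedge (uk + (δ * s) • wk) uk = -(δ * s) * wedge uk wk := by
        simp [wedge]; ring
      rw [act_transvection, this, hwedge k, mul_one, mul_neg, inv_mul_cancel₀ hσ.ne']
      module
    rw [← huk, ← hwk, ← hs, e, act_smul, ← act_orderedProd_succ] at h1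
    exact hno _ (h1.follow hη hk)
  have hgrow : ∀ k < n, δ ^ 4 * (∑ j ∈ Finset.range k, a j) ≤ a k := by
    intro k hk
    have h1 := hprod k hk
    have h2 := hangle k hk
    have hs : 0 ≤ ∑ j ∈ Finset.range k, a j := Finset.sum_nonneg fun j _ => (hapos j).le
    set s := ∑ j ∈ Finset.range k, a j
    calc δ ^ 4 * s = δ ^ 2 * (s * δ ^ 2) := by ring
      _ ≤ a k * b k * (s * δ ^ 2) := by gcongr
      _ = a k * (s * b k * δ ^ 2) := by ring
      _ ≤ a k * 1 := by gcongr; exact (hapos k).le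
      _ = a k := mul_one _
  have hsum : ∀ k < n, (1 + δ ^ 4) ^ k * a 0 ≤ ∑ j ∈ Finset.range (k + 1), a j := by
    intro k
    induction k with
    | zero => intro _; simp
    | succ k ih =>
      intro hk
      have h1 := ih (by omega)
      have h2 := hgrow (k + 1) hk
      rw [Finset.sum_range_succ, pow_succ]
      have h3 := mul_le_mul_of_nonneg_left h1 (show (0 : ℝ) ≤ 1 + δ ^ 4 by positivity)
      linarith
  have h1 := hsum m (by omega)
  have h2 := hgrow (m + 1) (by omega)
  have h3 : δ ^ 4 * ((1 + δ ^ 4) ^ m * a 0) ≤ a (m + 1) :=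
    (mul_le_mul_of_nonneg_left h1 (by positivity)).trans h2
  have h4 := normSq_le_mul_normSq_act (orderedProd M (m + 1)) w
  have h5 : a 0 = (normSq w)⁻¹ := by simp [ha, orderedProd, act_one]
  have h6 : 0 < normSq w := by simpa [orderedProd, act_one] using hwpos 0
  have h7 := hwpos (m + 1)
  have h8 : δ ^ 4 * (1 + δ ^ 4) ^ m * normSq (act (orderedProd M (m + 1)) w) ≤ normSq w := by
    rw [h5] at h3
    have h9 : δ ^ 4 * ((1 + δ ^ 4) ^ m * (normSq w)⁻¹) ≤
      (normSq (act (orderedProd M (m + 1)) w))⁻¹ := h3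
    rw [le_inv_comm₀ (by positivity) h7] at h9
    rw [← mul_assoc, mul_inv, inv_inv, ← div_eq_inv_mul, le_div_iff₀ (by positivity)] at h9
    linarith
  have := mul_lt_mul_of_pos_right hslow h7
  linarith

/-- Any segment has a time at which the growth before and the growth after are comparable. -/
lemma exists_balanced_time (M : ℕ → SL(2, ℝ)) {C : ℝ} (hC : ∀ j, sl2Norm (M j) ≤ C) (N : ℕ) :
    ∃ p ≤ N, sl2Norm (orderedProd (fun j => M (p + j)) (N - p)) ≤ sl2Norm (orderedProd M p) ∧
      sl2Norm (orderedProd M p) ≤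
        C ^ 2 * sl2Norm (orderedProd (fun j => M (p + j)) (N - p)) := by
  classical
  have hC1 : 1 ≤ C := (one_le_sl2Norm _).trans (hC 0)
  have hex : ∃ p, sl2Norm (orderedProd (fun j => M (p + j)) (N - p)) ≤
      sl2Norm (orderedProd M p) :=
    ⟨N, by simpa [orderedProd, sl2Norm_one] using one_le_sl2Norm _⟩
  have hfindN : Nat.find hex ≤ N :=
    Nat.find_min' hex (by simpa [orderedProd, sl2Norm_one] using one_le_sl2Norm _)
  refine ⟨Nat.find hex, hfindN, Nat.find_spec hex, ?_⟩
  rcases hp : Nat.find hex with _ | p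
  · have h1 := one_le_sl2Norm (orderedProd (fun j => M (0 + j)) (N - 0))
    rw [orderedProd, sl2Norm_one]
    nlinarith
  · have hlt := Nat.find_min hex (m := p) (by omega)
    push Not at hlt
    have e : N - p = 1 + (N - (p + 1)) := by omega
    rw [e, orderedProd_add] at hlt
    have h1 := sl2Norm_mul_le (orderedProd (fun j => M (p + (1 + j))) (N - (p + 1)))
      (orderedProd (fun j => M (p + j)) 1)
    have e2 : (fun j => M (p + (1 + j))) = fun j => M (p + 1 + j) := by
      funext j; rw [add_assoc]
    have e3 : sl2Norm (orderedProd (fun j => M (p + j)) 1) ≤ C := by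
      simpa [orderedProd] using hC p
    rw [e2] at h1 hlt
    set β := sl2Norm (orderedProd (fun j => M (p + 1 + j)) (N - (p + 1)))
    have hβ : 0 ≤ β := sl2Norm_nonneg _
    calc sl2Norm (orderedProd M (p + 1)) ≤ sl2Norm (M p) * sl2Norm (orderedProd M p) :=
          sl2Norm_mul_le _ _
      _ ≤ C * (β * C) :=
          mul_le_mul (hC p) (hlt.le.trans (h1.trans (mul_le_mul_of_nonneg_left e3 hβ)))
            (sl2Norm_nonneg _) (by linarith)
      _ = C ^ 2 * β := by ring

/-- If, with bounded gaps, there are windows of length `n` on which any direction can be moved to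
any other one, then every segment can be perturbed so that its product is bounded. -/
lemma exists_perturbation_bounded (M : ℕ → SL(2, ℝ)) {C ε : ℝ} (hε : 0 < ε)
    (hC : ∀ j, sl2Norm (M j) ≤ C) {n T : ℕ}
    (hwin : ∀ p, ∃ t, p ≤ t ∧ t ≤ p + T ∧ ∀ u v : Fin 2 → ℝ, v ≠ 0 →
      ∃ L : ℕ → SL(2, ℝ), (∀ j < n, matOpNorm ((L j : Matrix (Fin 2) (Fin 2) ℝ)
        - (M (t + j) : Matrix (Fin 2) (Fin 2) ℝ)) < ε) ∧
        ∃ c : ℝ, act (orderedProd L n) u = c • v) (N : ℕ) :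
    ∃ L : ℕ → SL(2, ℝ), (∀ j, matOpNorm ((L j : Matrix (Fin 2) (Fin 2) ℝ)
        - (M j : Matrix (Fin 2) (Fin 2) ℝ)) < ε) ∧
      sl2Norm (orderedProd L N) ≤ (C + ε) ^ n * (2 * (C ^ (T + n)) ^ 2 * C ^ 2) := by
  have hC1 : 1 ≤ C := (one_le_sl2Norm _).trans (hC 0)
  have hE : 1 ≤ C ^ (T + n) := one_le_pow₀ hC1
  have hκ : 1 ≤ (C + ε) ^ n := one_le_pow₀ (by linarith)
  have hpow : ∀ (q a : ℕ), a ≤ T + n → sl2Norm (orderedProd (fun j => M (q + j)) a)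
      ≤ C ^ (T + n) := fun q a ha =>
    (sl2Norm_orderedProd_le fun j _ => hC _).trans (pow_le_pow_right₀ hC1 ha)
  set E := C ^ (T + n)
  obtain ⟨p, hpN, hβα, hαβ⟩ := exists_balanced_time M hC N
  have hsplit := fun q b => orderedProd_add M q b
  have hα0 := one_le_sl2Norm (orderedProd M p)
  have hβ0 := one_le_sl2Norm (orderedProd (fun j => M (p + j)) (N - p))
  by_cases hend : N < p + T + n
  · refine ⟨M, fun j => by rw [sub_self, matOpNorm_zero]; exact hε, ?_⟩
    have e := hsplit p (N - p)
    rw [Nat.add_sub_cancel' hpN] at e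
    rw [e]
    have h1 := hpow p (N - p) (by omega)
    refine (sl2Norm_mul_le _ _).trans ?_
    set α := sl2Norm (orderedProd M p)
    set β := sl2Norm (orderedProd (fun j => M (p + j)) (N - p))
    calc β * α ≤ E * (C ^ 2 * E) :=
          mul_le_mul h1 (hαβ.trans (mul_le_mul_of_nonneg_left h1 (by positivity)))
            (by linarith) (by linarith)
      _ ≤ 1 * (2 * E ^ 2 * C ^ 2) := by nlinarith [show 0 ≤ E ^ 2 * C ^ 2 by positivity]
      _ ≤ _ := mul_le_mul_of_nonneg_right hκ (by positivity)
  obtain ⟨t, hpt, htT, hmove⟩ := hwin p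
  set X := orderedProd M t with hX
  set Y := orderedProd (fun j => M (t + n + j)) (N - (t + n)) with hY
  obtain ⟨u, v, -, hv, hbound⟩ := exists_directions_sl2Norm_mul_le X Y
  obtain ⟨L, hL, hLc⟩ := hmove u v hv
  set L' : ℕ → SL(2, ℝ) := fun j => if t ≤ j ∧ j < t + n then L (j - t) else M j with hL'
  refine ⟨L', fun j => ?_, ?_⟩
  · by_cases hj : t ≤ j ∧ j < t + n
    · have := hL (j - t) (by omega)
      rw [Nat.add_sub_cancel' hj.1] at this
      simpa [hL', hj] using this
    · simpa [hL', hj, matOpNorm_zero] using hε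
  have e : orderedProd L' N = Y * orderedProd L n * X := by
    have e1 : N = t + (n + (N - (t + n))) := by omega
    rw [e1, orderedProd_add, orderedProd_add, hX, hY]
    congr 1
    · congr 1
      · refine orderedProd_congr fun j _ => ?_
        simp only [hL']
        rw [if_neg (by omega), add_assoc]
      · refine orderedProd_congr fun j hj => ?_
        simp only [hL']
        rw [if_pos (by omega), Nat.add_sub_cancel_left]
    · refine orderedProd_congr fun j hj => ?_
      simp only [hL']
      rw [if_neg (by omega)]
  rw [e]
  refine (hbound _ hLc).trans ?_
  have hQ : sl2Norm (orderedProd L n) ≤ (C + ε) ^ n := by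
    refine sl2Norm_orderedProd_le fun j hj => ?_
    have h1 := matOpNorm_add_le (M (t + j) : Matrix (Fin 2) (Fin 2) ℝ)
      ((L j : Matrix (Fin 2) (Fin 2) ℝ) - (M (t + j) : Matrix (Fin 2) (Fin 2) ℝ))
    rw [add_sub_cancel] at h1
    have h2 : matOpNorm (M (t + j) : Matrix (Fin 2) (Fin 2) ℝ) ≤ C := hC _
    have h3 := hL j hj
    change matOpNorm _ ≤ _
    linarith
  have eX : X = orderedProd (fun j => M (p + j)) (t - p) * orderedProd M p := by
    rw [← hsplit, Nat.add_sub_cancel' hpt]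
  have eY : orderedProd (fun j => M (p + j)) (N - p)
      = Y * orderedProd (fun j => M (p + j)) (t + n - p) := by
    have := orderedProd_add (fun j => M (p + j)) (t + n - p) (N - (t + n))
    rw [show t + n - p + (N - (t + n)) = N - p by omega] at this
    rw [this]
    congr 2
    funext j
    congr 1
    omega
  have hZ := hpow p (t - p) (by omega)
  have hW := hpow p (t + n - p) (by omega)
  have x1 := sl2Norm_mul_le (orderedProd (fun j => M (p + j)) (t - p)) (orderedProd M p)
  have x2 := sl2Norm_le_mul_left (orderedProd (fun j => M (p + j)) (t - p)) (orderedProd M p)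
  have y1 := sl2Norm_mul_le Y (orderedProd (fun j => M (p + j)) (t + n - p))
  have y2 := sl2Norm_le_mul_right Y (orderedProd (fun j => M (p + j)) (t + n - p))
  rw [← eX] at x1 x2
  rw [← eY] at y1 y2
  have hX1 := one_le_sl2Norm X
  have hY1 := one_le_sl2Norm Y
  set ξ := sl2Norm X
  set ζ := sl2Norm Y
  set α := sl2Norm (orderedProd M p)
  set β := sl2Norm (orderedProd (fun j => M (p + j)) (N - p))
  have x3 : ξ ≤ E * α := x1.trans (by gcongr)
  have x4 : α ≤ E * ξ := x2.trans (by gcongr)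
  have y3 : β ≤ E * ζ := y1.trans (by rw [mul_comm]; gcongr)
  have y4 : ζ ≤ E * β := y2.trans (by rw [mul_comm]; gcongr)
  have r1 : ξ / ζ ≤ E ^ 2 * C ^ 2 := by
    rw [div_le_iff₀ (by linarith)]
    calc ξ ≤ E * α := x3
      _ ≤ E * (C ^ 2 * (E * ζ)) := by
          gcongr
          exact hαβ.trans (by gcongr)
      _ = _ := by ring
  have r2 : ζ / ξ ≤ E ^ 2 * C ^ 2 := by
    rw [div_le_iff₀ (by linarith)]
    calc ζ ≤ E * β := y4
      _ ≤ E * (E * ξ) := by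
          gcongr
          exact hβα.trans x4
      _ = E ^ 2 * 1 * ξ := by ring
      _ ≤ E ^ 2 * C ^ 2 * ξ := by
          gcongr
          exact one_le_pow₀ hC1
  have r3 : 0 ≤ ξ / ζ + ζ / ξ := by positivity
  calc sl2Norm (orderedProd L n) * (ξ / ζ + ζ / ξ)
      ≤ (C + ε) ^ n * (ξ / ζ + ζ / ξ) := mul_le_mul_of_nonneg_right hQ r3
    _ ≤ (C + ε) ^ n * (2 * E ^ 2 * C ^ 2) := mul_le_mul_of_nonneg_left (by linarith) (by linarith)

/-- A cocycle that is not uniformly hyperbolic has segments of slow growth. -/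
lemma exists_slow_growth {K : Type*} {f : K → K} {A : K → SL(2, ℝ)} (h : ¬ UnifHyp f A)
    {δ : ℝ} (hδ : 0 < δ) :
    ∃ (y : K) (m : ℕ), sl2Norm (orderedProd (fun j => A (f^[j] y)) (m + 1)) ^ 2
      < δ ^ 4 * (1 + δ ^ 4) ^ m := by
  set s := Real.sqrt (1 + δ ^ 4) with hs
  have hδ4 : 0 < δ ^ 4 := by positivity
  have hs2 : s ^ 2 = 1 + δ ^ 4 := Real.sq_sqrt (by positivity)
  have hs1 : 1 < s := by
    rw [hs, Real.lt_sqrt zero_le_one]; linarith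
  have hs0 : 0 < s := by linarith
  obtain ⟨k, hk⟩ := pow_unbounded_of_one_lt (s / δ ^ 4) hs1
  unfold UnifHyp at h
  push Not at h
  obtain ⟨y, n, hn, hlt⟩ := h (Real.log s / 2) (by have := Real.log_pos hs1; positivity) (k + 1)
  obtain ⟨m, rfl⟩ : ∃ m, n = m + 1 := ⟨n - 1, by omega⟩
  refine ⟨y, m, ?_⟩
  rw [cocycle_eq_orderedProd] at hlt
  have h1 := pow_lt_pow_left₀ hlt (sl2Norm_nonneg _) two_ne_zero
  have e : Real.exp (Real.log s / 2 * (m + 1 : ℕ)) ^ 2 = s ^ (m + 1) := by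
    rw [← Real.exp_nat_mul, show ((2 : ℕ) : ℝ) * (Real.log s / 2 * (m + 1 : ℕ))
      = (m + 1 : ℕ) * Real.log s by push_cast; ring, Real.exp_nat_mul, Real.exp_log hs0]
  rw [e] at h1
  refine h1.trans_le ?_
  rw [← hs2, pow_succ]
  rw [div_lt_iff₀ hδ4] at hk
  have h2 : s ^ k ≤ s ^ m := pow_le_pow_right₀ hs1.le (by omega)
  have h3 : s ≤ s ^ m * δ ^ 4 := hk.le.trans (mul_le_mul_of_nonneg_right h2 hδ4.le)
  calc s ^ m * s ≤ s ^ m * (s ^ m * δ ^ 4) := mul_le_mul_of_nonneg_left h3 (by positivity)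
    _ = δ ^ 4 * (s ^ 2) ^ m := by ring

/-- For a minimal homeomorphism, visits to a nonempty open set have bounded gaps. -/
lemma exists_bounded_return {K : Type*} [TopologicalSpace K] [CompactSpace K] (f : K ≃ₜ K)
    (hmin : ∀ x : K, Dense (Set.range fun n : ℤ => (f.toEquiv ^ n) x)) {U : Set K}
    (hU : IsOpen U) (hne : U.Nonempty) : ∃ T : ℕ, ∀ x : K, ∃ t ≤ T, f^[t] x ∈ U := by
  have hcont : ∀ n : ℤ, Continuous fun x => (f.toEquiv ^ n) x := by
    have hn : ∀ n : ℕ, Continuous fun x => (f.toEquiv ^ n) x := fun n => by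
      rw [show (fun x => (f.toEquiv ^ n) x) = f^[n] from Equiv.Perm.coe_pow _ _]
      exact f.continuous.iterate n
    have hn' : ∀ n : ℕ, Continuous fun x => ((f.toEquiv ^ n)⁻¹) x := fun n => by
      rw [← inv_pow, show (fun x => ((f.toEquiv⁻¹ ^ n)) x) = f.symm^[n] from Equiv.Perm.coe_pow _ _]
      exact f.symm.continuous.iterate n
    rintro (n | n)
    · simpa using hn n
    · simpa [zpow_negSucc] using hn' (n + 1)
  obtain ⟨F, hF⟩ := isCompact_univ.elim_finite_subcover
    (fun n : ℤ => (fun x => (f.toEquiv ^ n) x) ⁻¹' U) (fun n => hU.preimage (hcont n)) (by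
      intro x _
      obtain ⟨_, hz, n, rfl⟩ := (hmin x).inter_open_nonempty U hU hne
      exact Set.mem_iUnion.2 ⟨n, hz⟩)
  set R := F.sup Int.natAbs
  refine ⟨2 * R, fun x => ?_⟩
  have hx := hF (Set.mem_univ (f^[R] x))
  simp only [Set.mem_iUnion, Set.mem_preimage] at hx
  obtain ⟨n, hnF, hn⟩ := hx
  have hnR : n.natAbs ≤ R := Finset.le_sup (f := Int.natAbs) hnF
  refine ⟨(n + R).toNat, by omega, ?_⟩
  have e : f^[(n + R).toNat] x = (f.toEquiv ^ n) (f^[R] x) := by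
    have h1 : ∀ k : ℕ, f^[k] x = (f.toEquiv ^ (k : ℤ)) x := fun k => by
      rw [zpow_natCast, Equiv.Perm.coe_pow]; rfl
    rw [h1, h1, Int.toNat_of_nonneg (by omega), _root_.zpow_add, Equiv.Perm.mul_apply]
  rwa [e]

/-- Directions can be moved arbitrarily along the orbit segments that stay close to one with slow
growth. -/
lemma exists_perturbation_moving {M M' : ℕ → SL(2, ℝ)} {δ C ε : ℝ} (hδ : 0 < δ)
    (hδC : C * (2 * δ) ≤ ε / 2) (hC : ∀ j, sl2Norm (M j) ≤ C) {m : ℕ}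
    (hslow : sl2Norm (orderedProd M (m + 1)) ^ 2 < δ ^ 4 * (1 + δ ^ 4) ^ m)
    (hclose : ∀ j < m + 2, matOpNorm ((M j : Matrix (Fin 2) (Fin 2) ℝ)
      - (M' j : Matrix (Fin 2) (Fin 2) ℝ)) < ε / 2) (u : Fin 2 → ℝ) {v : Fin 2 → ℝ} (hv : v ≠ 0) :
    ∃ L : ℕ → SL(2, ℝ), (∀ j < m + 2, matOpNorm ((L j : Matrix (Fin 2) (Fin 2) ℝ)
      - (M' j : Matrix (Fin 2) (Fin 2) ℝ)) < ε) ∧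
      ∃ c : ℝ, act (orderedProd L (m + 2)) u = c • v := by
  obtain ⟨c, T, hT, hTc⟩ := reach_of_slow_growth M hδ hslow u hv
  refine ⟨fun j => M j * T j, fun j hj => ?_, c, hTc⟩
  have e : (((M j * T j : SL(2, ℝ)) : Matrix (Fin 2) (Fin 2) ℝ)
      - (M' j : Matrix (Fin 2) (Fin 2) ℝ)) =
      (M j : Matrix (Fin 2) (Fin 2) ℝ) * ((T j : Matrix (Fin 2) (Fin 2) ℝ) - 1)
        + ((M j : Matrix (Fin 2) (Fin 2) ℝ) - (M' j : Matrix (Fin 2) (Fin 2) ℝ)) := by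
    rw [Matrix.SpecialLinearGroup.coe_mul, mul_sub, mul_one]; abel
  rw [e]
  have h1 := matOpNorm_mul_le (M j : Matrix (Fin 2) (Fin 2) ℝ)
    ((T j : Matrix (Fin 2) (Fin 2) ℝ) - 1)
  have h2 := mul_le_mul (hC j) (hT j) (matOpNorm_nonneg _) ((sl2Norm_nonneg _).trans (hC j))
  refine (matOpNorm_add_le _ _).trans_lt ?_
  have h3 := hclose j hj
  unfold sl2Norm distOne at h2
  linarith

end SegmentPerturbation

open SegmentPerturbation

/-- Perturbation along segments of orbits making the product subexponentially
small (lemma 3.2). -/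
theorem stmt_4 {K : Type*} [MetricSpace K] [CompactSpace K]
    [MeasurableSpace K] [BorelSpace K]
    (f : K ≃ₜ K)
    (hmin : ∀ x : K, Dense (Set.range fun n : ℤ => (f.toEquiv ^ n) x))
    (hnoper : ∀ x : K, ∀ p : ℕ, 0 < p → (⇑f)^[p] x ≠ x)
    (A : C(K, Matrix.SpecialLinearGroup (Fin 2) ℝ))
    (hnuh : ¬ UnifHyp (⇑f) (⇑A))
    (hpos : ∃ μ : Measure K, IsProbabilityMeasure μ ∧ Measure.map (⇑f) μ = μ ∧
      ∃ Λ : ℝ, 0 < Λ ∧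
        Tendsto (fun m : ℕ =>
            (m : ℝ)⁻¹ * ∫ y, Real.log (sl2Norm (cocycle (⇑f) (⇑A) m y)) ∂μ)
          atTop (nhds Λ))
    (ε : ℝ) (hε : 0 < ε) :
    ∀ N₀ : ℕ, ∃ N : ℕ, N₀ ≤ N ∧
      ∀ x : K, ∃ L : Fin N → Matrix.SpecialLinearGroup (Fin 2) ℝ,
        (∀ j : Fin N, matOpNorm ((L j : Matrix (Fin 2) (Fin 2) ℝ)
            - (A ((⇑f)^[(j : ℕ)] x) : Matrix (Fin 2) (Fin 2) ℝ)) < ε) ∧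
        sl2Norm (List.ofFn L).reverse.prod < Real.exp (ε * N) := by
  intro N₀
  have hcoe : Continuous fun x => (A x : Matrix (Fin 2) (Fin 2) ℝ) :=
    continuous_induced_dom.comp A.continuous
  obtain ⟨C₀, hC₀⟩ := isCompact_univ.bddAbove_image
    (continuous_matOpNorm.comp hcoe).continuousOn
  set C := max C₀ 1
  have hC : ∀ x, sl2Norm (A x) ≤ C := fun x =>
    (hC₀ (Set.mem_image_of_mem _ (Set.mem_univ x))).trans (le_max_left _ _)
  have hCpos : 0 < C := lt_of_lt_of_le one_pos (le_max_right _ _)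
  set δ := ε / (4 * C) with hδdef
  have hδ : 0 < δ := by positivity
  have hδC : C * (2 * δ) ≤ ε / 2 := by
    rw [hδdef]; field_simp; norm_num
  obtain ⟨y, m, hslow⟩ := exists_slow_growth hnuh hδ
  set U : Set K := ⋂ j ∈ Finset.range (m + 2), {x | matOpNorm
    ((A ((⇑f)^[j] y) : Matrix (Fin 2) (Fin 2) ℝ)
      - (A ((⇑f)^[j] x) : Matrix (Fin 2) (Fin 2) ℝ)) < ε / 2} with hUdef
  have hUo : IsOpen U := isOpen_biInter_finset fun j _ =>
    isOpen_lt (continuous_matOpNorm.comp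
      (continuous_const.sub (hcoe.comp (f.continuous.iterate j)))) continuous_const
  have hyU : y ∈ U := by
    simp only [hUdef, Set.mem_iInter, Set.mem_ofPred_eq, sub_self, matOpNorm_zero]
    intros
    positivity
  obtain ⟨T, hT⟩ := exists_bounded_return f hmin hUo ⟨y, hyU⟩
  set D := (C + ε) ^ (m + 2) * (2 * (C ^ (T + (m + 2))) ^ 2 * C ^ 2)
  obtain ⟨N, hN, hND⟩ : ∃ N, N₀ ≤ N ∧ D < Real.exp (ε * N) := by
    obtain ⟨k, hk⟩ := exists_nat_gt (D / ε)
    refine ⟨max N₀ k, le_max_left _ _, ?_⟩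
    rw [div_lt_iff₀ hε] at hk
    have h1 : (k : ℝ) ≤ (max N₀ k : ℕ) := by exact_mod_cast le_max_right _ _
    have h2 := Real.add_one_le_exp (ε * (max N₀ k : ℕ))
    nlinarith
  refine ⟨N, hN, fun x => ?_⟩
  obtain ⟨L, hL, hLN⟩ := exists_perturbation_bounded (fun j => A ((⇑f)^[j] x)) hε
    (fun j => hC _) (n := m + 2) (T := T) (fun p => by
      obtain ⟨t, htT, ht⟩ := hT ((⇑f)^[p] x)
      refine ⟨p + t, by omega, by omega, fun u v hv => ?_⟩
      refine exists_perturbation_moving (M := fun j => A ((⇑f)^[j] y)) hδ hδC (fun j => hC _)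
        hslow (fun j hj => ?_) u hv
      simp only [hUdef, Set.mem_iInter, Finset.mem_range, Set.mem_ofPred_eq] at ht
      have := ht j hj
      rwa [← Function.iterate_add_apply, ← Function.iterate_add_apply,
        show j + t + p = p + t + j by omega] at this) N
  refine ⟨fun j => L j, fun j => hL j, ?_⟩
  rw [prod_reverse_ofFn]
  exact hLN.trans_lt hND
end

section
/- Let f : K → K be a homeomorphism with no periodic orbits of a compact metric space K of finite dimension. Then there exists a basis of the topology of K consisting of open sets U whose boundary ∂U (taken in K) is a zero probability set for f; that is, for every x ∈ K and every open set O containing x, there is an open set U with x ∈ U ⊆ O and μ(∂U)=0 for every f-invariant Borel probability measure μ. -/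
open MeasureTheory Filter Topology

section ZeroProbability

variable {K : Type*}

/-- On a compact space embedded in `ℝⁿ`, pullbacks of `C¹` functions are uniformly dense. -/
theorem exists_contDiff_comp_near [TopologicalSpace K] [CompactSpace K] {n : ℕ}
    {s : K → EuclideanSpace ℝ (Fin n)} (hs : Continuous s) (hinj : Function.Injective s)
    (h : C(K, ℝ)) {ε : ℝ} (hε : 0 < ε) :
    ∃ p : EuclideanSpace ℝ (Fin n) → ℝ, ContDiff ℝ 1 p ∧ ∀ x, |p (s x) - h x| < ε := by
  let A : Subalgebra ℝ C(K, ℝ) :=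
    { carrier := {φ | ∃ p : EuclideanSpace ℝ (Fin n) → ℝ, ContDiff ℝ 1 p ∧ ∀ x, φ x = p (s x)}
      mul_mem' := by
        rintro a b ⟨p, hp, hpa⟩ ⟨q, hq, hqb⟩
        exact ⟨fun v => p v * q v, hp.mul hq, fun x => by simp [hpa, hqb]⟩
      add_mem' := by
        rintro a b ⟨p, hp, hpa⟩ ⟨q, hq, hqb⟩
        exact ⟨fun v => p v + q v, hp.add hq, fun x => by simp [hpa, hqb]⟩
      algebraMap_mem' := fun r => ⟨fun _ => r, contDiff_const, fun x => by simp⟩ }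
  have hA : A.SeparatesPoints := by
    intro x y hxy
    obtain ⟨i, hi⟩ : ∃ i, s x i ≠ s y i := by
      by_contra! hall
      exact hxy (hinj (PiLp.ext hall))
    exact ⟨fun z => s z i, ⟨⟨fun z => s z i, by fun_prop⟩,
      ⟨fun v => v i, by fun_prop, fun _ => rfl⟩, rfl⟩, hi⟩
  obtain ⟨⟨g, p, hp, hgp⟩, hg⟩ :=
    ContinuousMap.exists_mem_subalgebra_near_continuous_of_separatesPoints A hA h h.continuous ε hε
  exact ⟨p, hp, fun x => by simpa [hgp, Real.norm_eq_abs] using hg x⟩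

/-- The functions whose translates by `F i` have no common zero on a compact set form an open set. -/
theorem isOpen_setOf_forall_exists_ne_zero [TopologicalSpace K] [CompactSpace K]
    {ι : Type*} (F : ι → K ≃ₜ K) {C : Set K} (hC : IsCompact C) :
    IsOpen {g : C(K, ℝ) | ∀ x ∈ C, ∃ i, g (F i x) ≠ 0} := by
  rw [isOpen_iff_eventually]
  intro g hg
  refine hC.eventually_forall_of_forall_eventually fun x hx => ?_
  obtain ⟨i, hi⟩ := hg x hx
  have hcont : Continuous fun z : C(K, ℝ) × K => z.1 (F i z.2) := by fun_prop
  filter_upwards [hcont.continuousAt.eventually_ne hi] with z hz using ⟨i, hz⟩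

/-- If the maps `F i` send `C` into pairwise disjoint open sets and there are more of them than the
dimension of the ambient Euclidean space, then a generic function has no point of `C` at which
all its translates by `F i` vanish. -/
theorem dense_setOf_forall_exists_ne_zero [TopologicalSpace K] [CompactSpace K] [T2Space K]
    {n : ℕ} {s : K → EuclideanSpace ℝ (Fin n)} (hs : Continuous s) (hinj : Function.Injective s)
    {ι : Type*} [Fintype ι] (hι : n < Fintype.card ι) (F : ι → K ≃ₜ K) {C : Set K}
    (hC : IsCompact C) {V : ι → Set K} (hV : ∀ i, IsOpen (V i))
    (hdisj : Pairwise fun i j => Disjoint (V i) (V j)) (hCV : ∀ i, ∀ x ∈ C, F i x ∈ V i) :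
    Dense {g : C(K, ℝ) | ∀ x ∈ C, ∃ i, g (F i x) ≠ 0} := by
  classical
  rw [Metric.dense_iff]
  intro g ε hε
  set δ : ℝ := ε / (4 * (Fintype.card ι + 1)) with hδ
  have hδ0 : 0 < δ := by positivity
  choose p hp hpg using fun i =>
    exists_contDiff_comp_near hs hinj (g.comp (F i : C(K, K))) hδ0
  have hφ : ∀ i, ∃ φ : C(K, ℝ), Set.EqOn φ 0 (V i)ᶜ ∧ Set.EqOn φ 1 (F i '' C) ∧
      ∀ x, φ x ∈ Set.Icc (0 : ℝ) 1 := fun i =>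
    exists_continuous_zero_one_of_isClosed (hV i).isClosed_compl
      (hC.image (F i).continuous).isClosed
      (Set.disjoint_compl_left_iff_subset.2 (Set.image_subset_iff.2 (hCV i)))
  choose φ hφ0 hφ1 hφI using hφ
  have hdense : Dense (Set.range fun v i => p i v)ᶜ :=
    ContDiff.dense_compl_range_of_finrank_lt_finrank (contDiff_pi.2 hp) (by simpa using hι)
  obtain ⟨a, ha, haδ⟩ := Metric.dense_iff.1 hdense 0 δ hδ0
  have hai : ∀ i, |a i| < δ := fun i => by
    have := (dist_pi_lt_iff hδ0).1 (Metric.mem_ball.1 ha) i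
    simpa using this
  let g' : C(K, ℝ) := ⟨fun y => g y + ∑ i, φ i y * (p i (s ((F i).symm y)) - a i - g y), by
    have := fun i => (hp i).continuous
    fun_prop⟩
  refine ⟨g', ?_, fun x hx => ?_⟩
  · rw [Metric.mem_ball, ContinuousMap.dist_lt_iff hε]
    intro y
    have hterm : ∀ i, |φ i y * (p i (s ((F i).symm y)) - a i - g y)| ≤ 2 * δ := fun i => by
      have h1 := hpg i ((F i).symm y)
      simp only [ContinuousMap.comp_apply, ContinuousMap.coe_coe, Homeomorph.apply_symm_apply] at h1
      have h2 : |p i (s ((F i).symm y)) - a i - g y| ≤ 2 * δ := by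
        have := hai i
        rw [abs_lt] at h1 this
        rw [abs_le]
        constructor <;> linarith
      rw [abs_mul, abs_of_nonneg (hφI i y).1]
      nlinarith [(hφI i y).2, abs_nonneg (p i (s ((F i).symm y)) - a i - g y)]
    have hsum : |∑ i, φ i y * (p i (s ((F i).symm y)) - a i - g y)| ≤
        Fintype.card ι * (2 * δ) := by
      refine (Finset.abs_sum_le_sum_abs _ _).trans ?_
      simpa using Finset.sum_le_card_nsmul Finset.univ _ (2 * δ) fun i _ => hterm i
    have hlt : Fintype.card ι * (2 * δ) < ε := by
      have hε' : ε = 4 * (Fintype.card ι + 1) * δ := by rw [hδ]; field_simp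
      nlinarith [(Nat.cast_nonneg (Fintype.card ι) : (0 : ℝ) ≤ _)]
    simpa [g', Real.dist_eq] using hsum.trans_lt hlt
  · have heval : ∀ i, g' (F i x) = p i (s x) - a i := fun i => by
      have hone : φ i (F i x) = 1 := hφ1 i ⟨x, hx, rfl⟩
      have hzero : ∀ j, j ≠ i → φ j (F i x) = 0 := fun j hj =>
        hφ0 j fun hmem => Set.disjoint_left.1 (hdisj hj) hmem (hCV i x hx)
      simp only [g', ContinuousMap.coe_mk]
      rw [Finset.sum_eq_single i (fun j _ hj => by rw [hzero j hj, zero_mul]) (by simp), hone]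
      simp
    by_contra! hall
    exact haδ ⟨s x, funext fun i => sub_eq_zero.1 ((heval i).symm.trans (hall i))⟩

/-- A generic function on a compact subspace of `ℝⁿ` has no common zero of its translates by more
than `n` homeomorphisms without coincidence points. -/
theorem dense_setOf_forall_exists_ne_zero_of_injective [TopologicalSpace K] [CompactSpace K] [T2Space K]
    {n : ℕ} {s : K → EuclideanSpace ℝ (Fin n)} (hs : Continuous s) (hinj : Function.Injective s)
    {ι : Type*} [Fintype ι] (hι : n < Fintype.card ι) (F : ι → K ≃ₜ K)
    (hF : ∀ x, Function.Injective fun i => F i x) :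
    Dense {g : C(K, ℝ) | ∀ x, ∃ i, g (F i x) ≠ 0} := by
  have hloc : ∀ x, ∃ C ∈ 𝓝 x, IsCompact C ∧
      Dense {g : C(K, ℝ) | ∀ y ∈ C, ∃ i, g (F i y) ≠ 0} := fun x => by
    obtain ⟨V, hV, hdisj⟩ := (Set.finite_range fun i => F i x).t2_separation
    have hmem : (⋂ i, F i ⁻¹' V (F i x)) ∈ 𝓝 x :=
      Filter.iInter_mem.2 fun i =>
        (F i).continuous.continuousAt.preimage_mem_nhds ((hV _).2.mem_nhds (hV _).1)
    obtain ⟨C, hCx, hCV, hC⟩ := local_compact_nhds hmem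
    refine ⟨C, hCx, hC, dense_setOf_forall_exists_ne_zero hs hinj hι F hC
      (V := fun i => V (F i x)) (fun i => (hV _).2) (fun i j hij => ?_)
      fun i y hy => Set.mem_iInter.1 (hCV hy) i⟩
    exact hdisj ⟨i, rfl⟩ ⟨j, rfl⟩ ((hF x).ne hij)
  choose C hCx hC hCd using hloc
  obtain ⟨t, -, ht⟩ := isCompact_univ.elim_nhds_subcover C fun x _ => hCx x
  refine (dense_biInter_of_isOpen (S := (t : Set K))
    (fun x _ => isOpen_setOf_forall_exists_ne_zero F (hC x)) t.countable_toSet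
    fun x _ => hCd x).mono fun g hg x => ?_
  obtain ⟨y, hy, hxy⟩ := Set.mem_iUnion₂.1 (ht (Set.mem_univ x))
  exact Set.mem_iInter₂.1 hg y hy x hxy

/-- A measurable set met by every orbit at most `n` times is null for every invariant probability
measure. -/
theorem measure_eq_zero_of_card_visits_le [MeasurableSpace K] {μ : Measure K}
    [IsProbabilityMeasure μ] {f : K → K} (hf : MeasurePreserving f μ μ) {Z : Set K}
    (hZ : MeasurableSet Z) {n : ℕ}
    (hcard : ∀ x, ∀ I : Finset ℕ, (∀ i ∈ I, f^[i] x ∈ Z) → I.card ≤ n) : μ Z = 0 := by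
  classical
  have hbound : ∀ M : ℕ, M * μ Z ≤ n := fun M => by
    have hmeas : ∀ i, MeasurableSet (f^[i] ⁻¹' Z) := fun i => (hf.iterate i).measurable hZ
    calc M * μ Z = ∑ i ∈ Finset.range M, μ (f^[i] ⁻¹' Z) := by
          simp [(hf.iterate _).measure_preimage hZ.nullMeasurableSet]
      _ = ∫⁻ x, ∑ i ∈ Finset.range M, (f^[i] ⁻¹' Z).indicator 1 x ∂μ := by
          rw [lintegral_finsetSum _ fun i _ => measurable_one.indicator (hmeas i)]
          simp only [lintegral_indicator_one (hmeas _)]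
      _ ≤ ∫⁻ _, n ∂μ := lintegral_mono fun x => by
          simp only [Set.indicator_apply, Set.mem_preimage, Pi.one_apply, Finset.sum_boole]
          exact_mod_cast hcard x _ fun i hi => (Finset.mem_filter.1 hi).2
      _ = n := by simp
  by_contra h0
  obtain ⟨M, hM⟩ := ENNReal.exists_nat_mul_gt h0 (ENNReal.natCast_ne_top n)
  exact (hbound M).not_gt hM

end ZeroProbability

/-- A basis of the topology consisting of open sets whose boundary has zero
probability (lemma 4.1). -/
theorem stmt_5 {K : Type*} [MetricSpace K] [CompactSpace K]
    [MeasurableSpace K] [BorelSpace K]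
    (hfd : ∃ n : ℕ, ∃ s : K → EuclideanSpace ℝ (Fin n), Topology.IsEmbedding s)
    (f : K ≃ₜ K)
    (hnoper : ∀ x : K, ∀ p : ℕ, 0 < p → (⇑f)^[p] x ≠ x) :
    ∀ x : K, ∀ O : Set K, IsOpen O → x ∈ O →
      ∃ U : Set K, IsOpen U ∧ x ∈ U ∧ U ⊆ O ∧
        ∀ μ : Measure K, IsProbabilityMeasure μ → Measure.map (⇑f) μ = μ →
          μ (frontier U) = 0 := by
  intro x O hO hxO
  obtain ⟨n, s, hs⟩ := hfd
  have hpow : ∀ (i : ℕ) (y : K), (f ^ i) y = f^[i] y := fun i y => by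
    induction i with
    | zero => rfl
    | succ i ih => rw [pow_succ', Function.iterate_succ_apply', ← ih]; rfl
  have hne : ∀ (y : K) {i j : ℕ}, i < j → f^[i] y ≠ f^[j] y := fun y i j hij heq => by
    refine hnoper y (j - i) (Nat.sub_pos_of_lt hij) (f.injective.iterate i ?_)
    rw [← Function.iterate_add_apply, Nat.add_sub_cancel' hij.le, heq]
  have horbit : ∀ y, Function.Injective fun i : ℕ => f^[i] y := fun y i j hij => by
    rcases lt_trichotomy i j with h | h | h
    · exact (hne y h hij).elim
    · exact h
    · exact (hne y h hij.symm).elim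
  have hgen : Dense (⋂ I ∈ {I : Finset ℕ | n < I.card},
      {g : C(K, ℝ) | ∀ y ∈ Set.univ, ∃ i : I, g ((f ^ (i : ℕ)) y) ≠ 0}) := by
    refine dense_biInter_of_isOpen
      (fun I _ => isOpen_setOf_forall_exists_ne_zero (fun i : I => f ^ (i : ℕ)) isCompact_univ)
      (Set.to_countable _) fun I hI => ?_
    simpa using dense_setOf_forall_exists_ne_zero_of_injective hs.continuous hs.injective (by simpa using hI)
      (fun i : I => f ^ (i : ℕ)) fun y i j hij =>
        Subtype.ext (horbit y (by simpa only [hpow] using hij))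
  obtain ⟨φ, hφ0, hφ1, -⟩ := exists_continuous_zero_one_of_isClosed
    (isClosed_singleton (x := x)) hO.isClosed_compl (by simpa using hxO)
  obtain ⟨g, hgball, hg⟩ := Metric.dense_iff.1 hgen (φ - ContinuousMap.const K (1 / 2))
    (1 / 4) (by norm_num)
  have hnear : ∀ y, |g y - (φ y - 1 / 2)| < 1 / 4 := fun y =>
    (ContinuousMap.dist_apply_le_dist y).trans_lt (Metric.mem_ball.1 hgball)
  refine ⟨{y | g y < 0}, isOpen_lt g.continuous continuous_const, ?_, fun y hy => ?_, ?_⟩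
  · have h0 : φ x = 0 := hφ0 rfl
    have := (abs_lt.1 (hnear x)).2
    rw [Set.mem_ofPred_eq]
    linarith
  · by_contra hyO
    have h1 : φ y = 1 := hφ1 hyO
    have := (abs_lt.1 (hnear y)).1
    rw [Set.mem_ofPred_eq] at hy
    linarith
  · intro μ hμ hinv
    refine measure_mono_null (frontier_lt_subset_eq g.continuous continuous_const)
      (measure_eq_zero_of_card_visits_le (n := n) ⟨f.continuous.measurable, hinv⟩
        (isClosed_eq g.continuous continuous_const).measurableSet fun y I hI => ?_)
    by_contra! hlt
    obtain ⟨i, hi⟩ := Set.mem_iInter₂.1 hg I hlt y (Set.mem_univ y)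
    exact hi (by rw [hpow]; exact hI i i.2)
end

section
/- Let K ⊂ ℝⁿ be a compact set and let f : K → K be a homeomorphism. Then, with d = 2n, there exist a topological embedding s : K → ℝ^d and a homeomorphism g : ℝ^d → ℝ^d such that s ∘ f = g ∘ s. (One may take s(x) = (x, f(x)) and g(x,y) = (y, x + φ(y) − ψ(y)) where φ, ψ : ℝⁿ → ℝⁿ are continuous extensions of f and f^{-1} respectively.) -/
open Topology

/-- The homeomorphism `(x, y) ↦ (y, x + h y)` of `E × E` associated with a continuous map `h`. -/
def Homeomorph.swapShear {E : Type*} [TopologicalSpace E] [AddGroup E]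
    [IsTopologicalAddGroup E] (h : C(E, E)) : E × E ≃ₜ E × E where
  toFun p := (p.2, p.1 + h p.2)
  invFun p := (p.2 - h p.1, p.1)
  left_inv p := by simp
  right_inv p := by simp
  continuous_toFun := by fun_prop
  continuous_invFun := by fun_prop

/-- A self-homeomorphism of a closed subset of `E` is conjugate, through the graph embedding, to
the restriction of a self-homeomorphism of `E × E`. -/
theorem Homeomorph.exists_graph_semiconj.{u} {E : Type u} [TopologicalSpace E] [NormalSpace E]
    [AddCommGroup E] [IsTopologicalAddGroup E] [TietzeExtension.{u} E]
    {K : Set E} (hK : IsClosed K) (f : K ≃ₜ K) :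
    ∃ g : E × E ≃ₜ E × E, ∀ x : K, g (x, f x) = (↑(f x), ↑(f (f x))) := by
  obtain ⟨φ, hφ⟩ := ContinuousMap.exists_restrict_eq hK
    (⟨fun x => (f x : E), by fun_prop⟩ : C(K, E))
  obtain ⟨ψ, hψ⟩ := ContinuousMap.exists_restrict_eq hK
    (⟨fun x => (f.symm x : E), by fun_prop⟩ : C(K, E))
  refine ⟨Homeomorph.swapShear (φ - ψ), fun x => ?_⟩
  have hφx : φ (f x) = f (f x) := DFunLike.congr_fun hφ (f x)
  have hψx : ψ (f x) = x := by simpa using DFunLike.congr_fun hψ (f x)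
  simp [Homeomorph.swapShear, hφx, hψx]

/-- A homeomorphism of a compact subset of ℝⁿ extends to (is conjugate to the
restriction of) a homeomorphism of ℝ^{2n} (lemma 4.2). -/
theorem stmt_6 {n : ℕ} (Kset : Set (Fin n → ℝ)) (hK : IsCompact Kset)
    (f : Kset ≃ₜ Kset) :
    ∃ s : Kset → (Fin (2 * n) → ℝ), Topology.IsEmbedding s ∧
      ∃ g : (Fin (2 * n) → ℝ) ≃ₜ (Fin (2 * n) → ℝ), s ∘ ⇑f = ⇑g ∘ s := by
  obtain ⟨g, hg⟩ := Homeomorph.exists_graph_semiconj hK.isClosed f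
  let e : ((Fin n → ℝ) × (Fin n → ℝ)) ≃ₜ (Fin (2 * n) → ℝ) :=
    (ContinuousLinearEquiv.ofFinrankEq (𝕜 := ℝ) (by simp [two_mul])).toHomeomorph
  have hgraph : IsEmbedding fun x : Kset => ((x : Fin n → ℝ), (f x : Fin n → ℝ)) :=
    .of_comp (by fun_prop) continuous_fst IsEmbedding.subtypeVal
  refine ⟨fun x => e (x, f x), e.isEmbedding.comp hgraph, (e.symm.trans g).trans e, ?_⟩
  ext1 x
  simp [hg]
end

section
/- Let f : ℝ^d → ℝ^d be a homeomorphism and let S be a compact topological manifold (without boundary) of dimension d−1. Then for a generic continuous map ψ : S → ℝ^d (i.e. for all ψ in some residual subset of C(S,ℝ^d) with the uniform topology), the following holds: for every strictly increasing sequence of integers j_0 < j_1 < ··· < j_d, the intersection ⋂_{k=0}^{d} f^{j_k}(ψ(S)) is contained in the set of periodic points of f. -/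
open Topology Filter

/-- The maps `ψ` for which the images `h k (ψ (K k))` of given closed sets have no common point
form an open set. -/
theorem isOpen_setOf_images_no_common_point {ι S E : Type*} [Nonempty ι] [TopologicalSpace S]
    [CompactSpace S] [T2Space S] [TopologicalSpace E] [T2Space E] (h : ι → E ≃ₜ E)
    (K : ι → Set S) (hK : ∀ k, IsClosed (K k)) :
    IsOpen {ψ : C(S, E) | ∀ s : ι → S, (∀ k, s k ∈ K k) → ¬ ∃ x, ∀ k, h k (ψ (s k)) = x} := by
  obtain ⟨k₀⟩ := ‹Nonempty ι›
  have hclosed : IsClosed {p : C(S, E) × (ι → S) |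
      (∀ k, p.2 k ∈ K k) ∧ ∀ k, h k (p.1 (p.2 k)) = h k₀ (p.1 (p.2 k₀))} := by
    simp only [Set.ofPred_and, Set.ofPred_forall]
    refine (isClosed_iInter fun k ↦ (hK k).preimage (by fun_prop)).inter
      (isClosed_iInter fun k ↦ isClosed_eq ?_ ?_)
    · exact (h k).continuous.comp (by fun_prop)
    · exact (h k₀).continuous.comp (by fun_prop)
  convert (isClosedMap_fst_of_compactSpace _ hclosed).isOpen_compl using 1
  ext ψ
  simp only [Set.mem_ofPred_eq, Set.mem_compl_iff, Set.mem_image, Prod.exists, not_exists]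
  constructor
  · rintro H _ s ⟨⟨hs, heq⟩, rfl⟩
    exact H s hs _ heq
  · intro H s hs x hx
    exact H ψ s ⟨⟨hs, fun k ↦ (hx k).trans (hx k₀).symm⟩, rfl⟩

/-- A dense set of translates of finitely many `C¹` images has no common point, if the dimension
count allows it. -/
theorem dense_translations_no_common_point {ι V E : Type*} [Fintype ι]
    [NormedAddCommGroup V] [NormedSpace ℝ V] [FiniteDimensional ℝ V]
    [NormedAddCommGroup E] [NormedSpace ℝ E] [FiniteDimensional ℝ E]
    (hdim : Fintype.card ι * Module.finrank ℝ V + Module.finrank ℝ E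
      < Fintype.card ι * Module.finrank ℝ E)
    (g : ι → V → E) (hg : ∀ k, ContDiff ℝ 1 (g k)) :
    Dense {v : ι → E | ∀ s : ι → V, ¬ ∃ x, ∀ k, g k (s k) + v k = x} := by
  have hsmooth : ContDiff ℝ 1 (fun p : (ι → V) × E ↦ fun k ↦ p.2 - g k (p.1 k)) := by
    rw [contDiff_pi]
    intro k
    exact contDiff_snd.sub ((hg k).comp ((contDiff_apply ℝ V k).comp contDiff_fst))
  refine (hsmooth.dense_compl_range_of_finrank_lt_finrank ?_).mono ?_
  · simpa [Module.finrank_pi_fintype] using hdim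
  · rintro v hv s ⟨x, hx⟩
    refine hv ⟨(s, x), funext fun k ↦ ?_⟩
    simp [← hx k]

/-- A continuous map on a compact set that embeds in a finite-dimensional space can be
approximated, after conjugation by a homeomorphism of the target, by all small translates of a
smooth map. -/
theorem exists_contDiff_translates_approx {S V E : Type*} [TopologicalSpace S]
    [NormedAddCommGroup V] [NormedSpace ℝ V] [FiniteDimensional ℝ V]
    [NormedAddCommGroup E] [NormedSpace ℝ E] [FiniteDimensional ℝ E]
    (h : E ≃ₜ E) {K : Set S} (hK : IsCompact K) {e : S → V} (he : ContinuousOn e K)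
    (hinj : Set.InjOn e K) (ψ : C(S, E)) {ε : ℝ} (hε : 0 < ε) :
    ∃ g : V → E, ContDiff ℝ 1 g ∧ ∃ δ > 0, ∀ v : E, ‖v‖ < δ → ∀ s ∈ K,
      dist (h.symm (g (e s) + v)) (ψ s) < ε := by
  have hcomp : IsCompact ((fun s ↦ h (ψ s)) '' K) :=
    hK.image (h.continuous.comp ψ.continuous)
  obtain ⟨δ, hδ, hunif⟩ := Metric.mem_uniformity_dist.1
    (hcomp.uniformContinuousAt_of_continuousAt h.symm
      (fun _ _ ↦ h.symm.continuous.continuousAt) (Metric.dist_mem_uniformity hε))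
  have : CompactSpace K := isCompact_iff_compactSpace.1 hK
  have hemb : IsClosedEmbedding (fun s : K ↦ e s) :=
    (continuousOn_iff_continuous_domRestrict.1 he).isClosedEmbedding hinj.injective
  have : TietzeExtension E := RCLike.instTietzeExtensionTVS (𝕜 := ℝ)
  obtain ⟨G, hG⟩ := ContinuousMap.exists_extension' hemb
    (⟨fun s : K ↦ h (ψ s), by fun_prop⟩ : C(K, E))
  obtain ⟨g, hg, hgG, -⟩ := G.continuous.exists_contDiff_approx 1
    (continuous_const (y := δ / 2)) (fun _ ↦ half_pos hδ)
  refine ⟨g, mod_cast hg, δ / 2, half_pos hδ, fun v hv s hs ↦ ?_⟩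
  have hGs : G (e s) = h (ψ s) := congrFun hG ⟨s, hs⟩
  have hdist : dist (h (ψ s)) (g (e s) + v) < δ := by
    rw [dist_comm, ← hGs]
    calc dist (g (e s) + v) (G (e s))
        ≤ dist (g (e s) + v) (g (e s)) + dist (g (e s)) (G (e s)) := dist_triangle _ _ _
      _ < δ / 2 + δ / 2 := add_lt_add (by simpa using hv) (hgG _)
      _ = δ := add_halves δ
  have := hunif hdist ⟨s, hs, rfl⟩
  simpa [dist_comm] using this

/-- Small perturbations prescribed on finitely many disjoint compact sets extend to a small
perturbation of the whole map. -/
theorem exists_continuousMap_eqOn_of_dist_le {ι S E : Type*} [Finite ι] [TopologicalSpace S]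
    [CompactSpace S] [T2Space S]
    [NormedAddCommGroup E] [NormedSpace ℝ E] [FiniteDimensional ℝ E]
    {K : ι → Set S} (hK : ∀ k, IsClosed (K k)) (hdisj : Pairwise (Function.onFun Disjoint K))
    (ψ : C(S, E)) (p : ι → S → E) (hp : ∀ k, ContinuousOn (p k) (K k)) {ε : ℝ} (hε : 0 < ε)
    (hdist : ∀ k, ∀ s ∈ K k, dist (p k s) (ψ s) ≤ ε) :
    ∃ φ : C(S, E), dist φ ψ ≤ ε ∧ ∀ k, Set.EqOn φ (p k) (K k) := by
  have : ∀ k, CompactSpace (K k) := fun k ↦ isCompact_iff_compactSpace.1 (hK k).isCompact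
  have hemb : IsClosedEmbedding (fun a : Σ k, K k ↦ (a.2 : S)) := by
    refine Continuous.isClosedEmbedding (continuous_sigma fun _ ↦ continuous_subtype_val) ?_
    rintro ⟨k, s, hs⟩ ⟨l, t, ht⟩ (rfl : s = t)
    obtain rfl : k = l := by
      by_contra hkl
      exact Set.disjoint_left.1 (hdisj hkl) hs ht
    rfl
  have := Metric.instTietzeExtensionClosedBall ℝ (0 : E) hε
  have hcont : Continuous (fun a : Σ k, K k ↦ p a.1 a.2 - ψ a.2) :=
    continuous_sigma fun k ↦
      (continuousOn_iff_continuous_domRestrict.1 (hp k)).sub (by fun_prop)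
  obtain ⟨u, hu, hext⟩ := ContinuousMap.exists_extension_forall_mem hemb
    (⟨_, hcont⟩ : C(Σ k, K k, E)) (t := Metric.closedBall 0 ε)
    (fun a ↦ by simpa [dist_eq_norm] using hdist a.1 a.2 a.2.2)
  refine ⟨ψ + u, (ContinuousMap.dist_le hε.le).2 fun s ↦ ?_, fun k s hs ↦ ?_⟩
  · simpa using hu s
  · have : u s = p k s - ψ s := DFunLike.congr_fun hext ⟨k, s, hs⟩
    simp [this]

/-- Given finitely many disjoint compact sets `K k` of low dimension, the maps `ψ` for which the
images `h k (ψ (K k))` have no common point are dense. -/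
theorem dense_setOf_images_no_common_point {ι S V E : Type*} [Fintype ι] [TopologicalSpace S]
    [CompactSpace S] [T2Space S]
    [NormedAddCommGroup V] [NormedSpace ℝ V] [FiniteDimensional ℝ V]
    [NormedAddCommGroup E] [NormedSpace ℝ E] [FiniteDimensional ℝ E]
    (hdim : Fintype.card ι * Module.finrank ℝ V + Module.finrank ℝ E
      < Fintype.card ι * Module.finrank ℝ E)
    (h : ι → E ≃ₜ E) {K : ι → Set S} (hK : ∀ k, IsClosed (K k))
    (hdisj : Pairwise (Function.onFun Disjoint K))
    {e : ι → S → V} (he : ∀ k, ContinuousOn (e k) (K k)) (hinj : ∀ k, Set.InjOn (e k) (K k)) :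
    Dense {ψ : C(S, E) | ∀ s : ι → S, (∀ k, s k ∈ K k) → ¬ ∃ x, ∀ k, h k (ψ (s k)) = x} := by
  refine Metric.dense_iff.2 fun ψ r hr ↦ ?_
  choose g hg δ hδ happrox using fun k ↦ exists_contDiff_translates_approx (h k)
    (hK k).isCompact (he k) (hinj k) ψ (half_pos hr)
  obtain ⟨v, hv, hvδ⟩ := (dense_translations_no_common_point hdim g hg).exists_mem_open
    (isOpen_set_pi Set.finite_univ fun k _ ↦ Metric.isOpen_ball (x := (0 : E)) (ε := δ k))
    ⟨0, fun k _ ↦ Metric.mem_ball_self (hδ k)⟩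
  obtain ⟨φ, hφ, heq⟩ := exists_continuousMap_eqOn_of_dist_le hK hdisj ψ
    (fun k s ↦ (h k).symm (g k (e k s) + v k))
    (fun k ↦ (h k).symm.continuous.comp_continuousOn
      (((hg k).continuous.comp_continuousOn (he k)).add continuousOn_const))
    (half_pos hr)
    (fun k s hs ↦ (happrox k (v k) (by simpa using hvδ k trivial) s hs).le)
  refine ⟨φ, hφ.trans_lt (half_lt_self hr), ?_⟩
  rintro s hs ⟨x, hx⟩
  refine hv (fun k ↦ e k (s k)) ⟨x, fun k ↦ ?_⟩
  rw [← hx k, heq k (hs k), Homeomorph.apply_symm_apply]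

/-- Distinct points of a regular Hausdorff space, given with neighbourhoods, are contained in
members of a topological basis with disjoint closures inside these neighbourhoods. -/
theorem exists_basis_disjoint_closure {ι S : Type*} [Finite ι] [TopologicalSpace S] [T2Space S]
    [RegularSpace S] {B : Set (Set S)} (hB : TopologicalSpace.IsTopologicalBasis B)
    {s : ι → S} (hs : Function.Injective s) {U : ι → Set S} (hU : ∀ k, U k ∈ 𝓝 (s k)) :
    ∃ b : ι → B, (∀ k, s k ∈ closure (b k : Set S)) ∧ (∀ k, closure (b k : Set S) ⊆ U k) ∧
      Pairwise (Function.onFun Disjoint fun k ↦ closure (b k : Set S)) := by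
  obtain ⟨W, hW, hWdisj⟩ := (Set.finite_range s).t2_separation
  choose b hbB hsb hbU using fun k ↦ hB.exists_closure_subset
    (inter_mem (hU k) ((hW (s k)).2.mem_nhds (hW (s k)).1))
  refine ⟨fun k ↦ ⟨b k, hbB k⟩, fun k ↦ subset_closure (hsb k),
    fun k ↦ (hbU k).trans Set.inter_subset_left, fun k l hkl ↦ ?_⟩
  exact (hWdisj ⟨k, rfl⟩ ⟨l, rfl⟩ (hs.ne hkl)).mono
    ((hbU k).trans Set.inter_subset_right) ((hbU l).trans Set.inter_subset_right)

/-- A point reached from the same point by two different iterates of a permutation is periodic. -/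
theorem exists_iterate_eq_of_zpow_eq {X : Type*} (f : Equiv.Perm X) {i j : ℤ} (hij : i ≠ j)
    {x y : X} (hi : (f ^ i) y = x) (hj : (f ^ j) y = x) : ∃ p : ℕ, 1 ≤ p ∧ f^[p] x = x := by
  wlog hlt : i < j generalizing i j
  · exact this hij.symm hj hi (lt_of_le_of_ne (not_lt.1 hlt) hij.symm)
  refine ⟨(j - i).toNat, by omega, ?_⟩
  have hcast : ((j - i).toNat : ℤ) = j - i := by omega
  rw [Equiv.Perm.iterate_eq_pow, ← zpow_natCast, hcast]
  nth_rw 1 [← hi]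
  rw [← Equiv.Perm.mul_apply, ← zpow_add, sub_add_cancel, hj]

theorem Homeomorph.toEquiv_zpow {X : Type*} [TopologicalSpace X] (f : X ≃ₜ X) (n : ℤ) :
    (f ^ n).toEquiv = (f.toEquiv ^ n : Equiv.Perm X) :=
  map_zpow (⟨⟨Homeomorph.toEquiv, rfl⟩, fun _ _ ↦ rfl⟩ : (X ≃ₜ X) →* Equiv.Perm X) f n

/-- For a generic continuous map ψ from a compact (d−1)-manifold into ℝ^d, any
d+1 distinct integer iterates of ψ(S) under a homeomorphism f intersect only in
periodic points (lemma 4.3). -/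
theorem stmt_7 {d : ℕ} (hd : 1 ≤ d)
    (f : EuclideanSpace ℝ (Fin d) ≃ₜ EuclideanSpace ℝ (Fin d))
    {S : Type*} [TopologicalSpace S] [CompactSpace S] [T2Space S]
    [ChartedSpace (EuclideanSpace ℝ (Fin (d - 1))) S] :
    ∃ R ∈ residual C(S, EuclideanSpace ℝ (Fin d)),
      ∀ ψ ∈ R, ∀ j : Fin (d + 1) → ℤ, StrictMono j →
        (⋂ k : Fin (d + 1), (f.toEquiv ^ (j k)) '' Set.range ⇑ψ)
          ⊆ {x | ∃ p : ℕ, 1 ≤ p ∧ (⇑f)^[p] x = x} := by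
  have : SecondCountableTopology S :=
    ChartedSpace.secondCountable_of_sigmaCompact (EuclideanSpace ℝ (Fin (d - 1))) S
  obtain ⟨B, hBc, -, hB⟩ := TopologicalSpace.exists_countable_basis S
  have : Countable B := hBc
  have hdim : Fintype.card (Fin (d + 1)) * Module.finrank ℝ (EuclideanSpace ℝ (Fin (d - 1))) +
      Module.finrank ℝ (EuclideanSpace ℝ (Fin d)) <
      Fintype.card (Fin (d + 1)) * Module.finrank ℝ (EuclideanSpace ℝ (Fin d)) := by
    obtain ⟨m, rfl⟩ := Nat.exists_eq_add_of_le' hd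
    simp only [Fintype.card_fin, finrank_euclideanSpace, Nat.add_sub_cancel]
    nlinarith
  let chartsCover (b : Fin (d + 1) → B) (c : Fin (d + 1) → S) : Prop := ∀ k,
    closure (b k : Set S) ⊆ (chartAt (EuclideanSpace ℝ (Fin (d - 1))) (c k)).source
  let good (b : Fin (d + 1) → B) (j : Fin (d + 1) → ℤ) : Set C(S, EuclideanSpace ℝ (Fin d)) :=
    {ψ | ∀ s : Fin (d + 1) → S, (∀ k, s k ∈ closure (b k : Set S)) →
      ¬ ∃ x, ∀ k, (f ^ j k) (ψ (s k)) = x}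
  refine ⟨⋂ (b : Fin (d + 1) → B) (j : Fin (d + 1) → ℤ), {ψ | (∃ c, chartsCover b c) →
    Pairwise (Function.onFun Disjoint fun k ↦ closure (b k : Set S)) → ψ ∈ good b j}, ?_, ?_⟩
  · refine countable_iInter_mem.2 fun b ↦ countable_iInter_mem.2 fun j ↦ ?_
    by_cases hb : (∃ c, chartsCover b c) ∧
      Pairwise (Function.onFun Disjoint fun k ↦ closure (b k : Set S))
    · obtain ⟨⟨c, hc⟩, hdisj⟩ := hb
      refine mem_of_superset (residual_of_dense_open
        (isOpen_setOf_images_no_common_point (fun k ↦ f ^ j k) _ fun k ↦ isClosed_closure)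
        (dense_setOf_images_no_common_point hdim (fun k ↦ f ^ j k) (fun k ↦ isClosed_closure)
          hdisj (fun k ↦ (chartAt _ (c k)).continuousOn.mono (hc k))
          (fun k ↦ (chartAt _ (c k)).injOn.mono (hc k)))) fun ψ hψ _ _ ↦ hψ
    · exact mem_of_superset univ_mem fun ψ _ h₁ h₂ ↦ absurd ⟨h₁, h₂⟩ hb
  · intro ψ hψ j hj x hx
    have hpre : ∀ k, ∃ s, (f.toEquiv ^ j k) (ψ s) = x := fun k ↦ by
      obtain ⟨_, ⟨s, rfl⟩, hs⟩ := Set.mem_iInter.1 hx k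
      exact ⟨s, hs⟩
    choose s hs using hpre
    by_contra hper
    have hinj : Function.Injective s := by
      intro k l hkl
      by_contra hne
      exact hper (exists_iterate_eq_of_zpow_eq f.toEquiv (hj.injective.ne hne) (hs k)
        (hkl ▸ hs l))
    obtain ⟨b, hsb, hbU, hdisj⟩ := exists_basis_disjoint_closure hB hinj
      fun k ↦ chart_source_mem_nhds (EuclideanSpace ℝ (Fin (d - 1))) (s k)
    refine Set.mem_iInter₂.1 hψ b j ⟨s, hbU⟩ hdisj s hsb ⟨x, fun k ↦ ?_⟩
    rw [← hs k, ← Homeomorph.toEquiv_zpow]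
    rfl
end

section
/- Let f : ℝ^d → ℝ^d be a homeomorphism, let S be a compact topological manifold (without boundary) of dimension d−1, let j_0 < j_1 < ··· < j_d be integers, and let U_0, …, U_d ⊂ S be open sets whose closures are pairwise disjoint and such that each closure \overline{U_k} is contained in the domain V_k of a chart g_k : V_k → ℝ^{d−1}. Then the set of continuous maps ψ : S → ℝ^d satisfying ⋂_{k=0}^{d} f^{j_k}(ψ(\overline{U_k})) = ∅ is open and dense in C(S,ℝ^d) with the uniform topology. -/
open Topology Filter

/-- A continuous map on a compact space that embeds into a finite-dimensional space factors, up to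
an arbitrarily small error, through a `C¹` map of that space. -/
theorem ContinuousMap.exists_contDiff_comp_dist_lt {E F K : Type*}
    [NormedAddCommGroup E] [NormedSpace ℝ E] [FiniteDimensional ℝ E]
    [NormedAddCommGroup F] [NormedSpace ℝ F] [FiniteDimensional ℝ F]
    [TopologicalSpace K] [CompactSpace K] {g : K → E} (hg : IsEmbedding g)
    (φ : C(K, F)) {ε : ℝ} (hε : 0 < ε) :
    ∃ p : E → F, ContDiff ℝ 1 p ∧ ∀ x, dist (p (g x)) (φ x) < ε := by
  have : TietzeExtension F := TietzeExtension.of_tvs ℝ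
  have hcl : IsClosedEmbedding g := ⟨hg, (isCompact_range hg.continuous).isClosed⟩
  obtain ⟨Φ, hΦ⟩ := φ.exists_extension' hcl
  obtain ⟨p, hp⟩ := exists_contMDiffMap_forall_mem_convex_of_local_const (n := 1)
    (modelWithCornersSelf ℝ E) (t := fun x => Metric.ball (Φ x) ε)
    (fun x => convex_ball _ _) fun x => ⟨Φ x, by
      filter_upwards [Φ.continuous.continuousAt.eventually (Metric.ball_mem_nhds (Φ x) hε)]
        with y hy
      exact Metric.mem_ball_comm.1 hy⟩
  refine ⟨p, p.contMDiff.contDiff, fun x => ?_⟩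
  have := hp (g x)
  rwa [show Φ (g x) = φ x from congrFun hΦ x] at this

section CommonValue

variable {ι F : Type*} {K : ι → Type*} [∀ i, TopologicalSpace (K i)]

/-- The families of continuous maps whose images have no common point. -/
def noCommonValue [TopologicalSpace F] : Set (∀ i, C(K i, F)) :=
  {φ | ∀ x : ∀ i, K i, ¬ ∃ y, ∀ i, φ i (x i) = y}

theorem isOpen_noCommonValue [TopologicalSpace F] [T2Space F] [Nonempty ι]
    [∀ i, CompactSpace (K i)] [∀ i, T2Space (K i)] :
    IsOpen (noCommonValue : Set (∀ i, C(K i, F))) := by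
  have hcl : IsClosed {q : (∀ i, K i) × (∀ i, C(K i, F)) |
      ∀ i l, q.2 i (q.1 i) = q.2 l (q.1 l)} := by
    simp only [Set.ofPred_forall]
    exact isClosed_iInter fun i => isClosed_iInter fun l =>
      isClosed_eq (by fun_prop) (by fun_prop)
  rw [← isClosed_compl_iff]
  convert isClosedMap_snd_of_compactSpace _ hcl
  ext φ
  simp only [noCommonValue, Set.mem_compl_iff, Set.mem_ofPred_eq, not_forall, not_not, Set.mem_image,
    Prod.exists, exists_eq_right]
  refine exists_congr fun x => ⟨fun ⟨y, hy⟩ i l => (hy i).trans (hy l).symm, fun h => ?_⟩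
  exact ⟨_, fun i => h i (Classical.arbitrary ι)⟩

/-- If the dimension count forces `ι`-many parametrised sets in general position to have empty
intersection, then generic families of continuous maps have no common value. -/
theorem dense_noCommonValue [Fintype ι] {E : Type*}
    [NormedAddCommGroup E] [NormedSpace ℝ E] [FiniteDimensional ℝ E]
    [NormedAddCommGroup F] [NormedSpace ℝ F] [FiniteDimensional ℝ F]
    [∀ i, CompactSpace (K i)] {g : ∀ i, K i → E} (hg : ∀ i, IsEmbedding (g i))
    (hdim : Module.finrank ℝ F + Fintype.card ι * Module.finrank ℝ E <
      Fintype.card ι * Module.finrank ℝ F) :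
    Dense (noCommonValue : Set (∀ i, C(K i, F))) := by
  refine Metric.dense_iff.2 fun φ ε hε => ?_
  choose p hp hpφ using fun i => (φ i).exists_contDiff_comp_dist_lt (hg i) (half_pos (half_pos hε))
  let Φ : F × (ι → E) → (ι → F) := fun q i => q.1 - p i (q.2 i)
  have hΦ : ContDiff ℝ 1 Φ := contDiff_pi.2 fun i =>
    contDiff_fst.sub ((hp i).comp ((contDiff_apply ℝ E i).comp contDiff_snd))
  have hdense := hΦ.dense_compl_range_of_finrank_lt_finrank
    (by simpa [Module.finrank_pi_fintype] using hdim)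
  obtain ⟨v, hvε, hv⟩ := Metric.dense_iff.1 hdense 0 (ε / 4) (by positivity)
  have hvi : ∀ i, ‖v i‖ < ε / 4 := fun i =>
    (norm_le_pi_norm v i).trans_lt (mem_ball_zero_iff.1 hvε)
  refine ⟨fun i => ⟨fun x => p i (g i x) + v i,
    ((hp i).continuous.comp (hg i).continuous).add continuous_const⟩, ?_, ?_⟩
  · refine Metric.mem_ball.2 (lt_of_le_of_lt ((dist_pi_le_iff (half_pos hε).le).2 fun i =>
      (ContinuousMap.dist_le (half_pos hε).le).2 fun x => ?_) (half_lt_self hε))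
    have h₁ := hpφ i x
    have h₂ := dist_triangle (p i (g i x) + v i) (p i (g i x)) (φ i x)
    have h₃ : dist (p i (g i x) + v i) (p i (g i x)) < ε / 4 := by simpa using hvi i
    change dist (p i (g i x) + v i) (φ i x) ≤ _
    linarith
  · rintro x ⟨y, hy⟩
    refine hv ⟨(y, fun i => g i (x i)), funext fun i => ?_⟩
    exact sub_eq_of_eq_add' (hy i).symm

end CommonValue

/-- Restriction of continuous maps to finitely many pairwise disjoint closed subsets is open. -/
theorem ContinuousMap.isOpenMap_restrict_pi {ι S F : Type*} [Fintype ι]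
    [TopologicalSpace S] [CompactSpace S] [T2Space S]
    [NormedAddCommGroup F] [NormedSpace ℝ F] [FiniteDimensional ℝ F]
    {A : ι → Set S} (hA : ∀ i, IsClosed (A i)) (hdisj : Pairwise fun i l => Disjoint (A i) (A l)) :
    IsOpenMap fun (ψ : C(S, F)) i => ψ.restrict (A i) := by
  have : TietzeExtension F := TietzeExtension.of_tvs ℝ
  have : CompleteSpace F := FiniteDimensional.complete ℝ F
  have : ∀ i, CompactSpace (A i) := fun i => isCompact_iff_compactSpace.1 (hA i).isCompact
  let R : C(S, F) →L[ℝ] ∀ i, C(A i, F) := ContinuousLinearMap.pi fun i =>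
    ContinuousMap.compCLM ℝ F ⟨Subtype.val, continuous_subtype_val⟩
  refine R.isOpenMap fun η => ?_
  let e : C((Σ i, A i), S) := .sigma fun i => ⟨Subtype.val, continuous_subtype_val⟩
  have he : IsClosedEmbedding e := by
    refine e.continuous.isClosedEmbedding ?_
    rintro ⟨i, x⟩ ⟨l, y⟩ (hxy : (x : S) = y)
    obtain rfl : i = l := by
      by_contra hne
      exact (hdisj hne).le_bot ⟨x.2, hxy ▸ y.2⟩
    rw [Subtype.ext hxy]
  obtain ⟨ψ, hψ⟩ := (ContinuousMap.sigma η).exists_extension he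
  refine ⟨ψ, funext fun i => ContinuousMap.ext fun x => ?_⟩
  exact DFunLike.congr_fun hψ ⟨i, x⟩

/-- The integer powers of a homeomorphism, taken in the permutation group, are homeomorphisms. -/
theorem Homeomorph.exists_coe_eq_zpow {X : Type*} [TopologicalSpace X] (f : X ≃ₜ X) (n : ℤ) :
    ∃ h : X ≃ₜ X, ⇑h = ⇑(f.toEquiv ^ n) := by
  let toPerm : (X ≃ₜ X) →* Equiv.Perm X :=
    { toFun := Homeomorph.toEquiv, map_one' := rfl, map_mul' := fun _ _ => rfl }
  exact ⟨f ^ n, congrArg DFunLike.coe (map_zpow toPerm f n)⟩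

/-- The set of continuous maps ψ for which prescribed iterates of the images of
the closures of given chart-contained open sets have empty intersection is open
and dense (claim inside lemma 4.3). -/
theorem stmt_8 {d : ℕ} (hd : 1 ≤ d)
    (f : EuclideanSpace ℝ (Fin d) ≃ₜ EuclideanSpace ℝ (Fin d))
    {S : Type*} [TopologicalSpace S] [CompactSpace S] [T2Space S]
    [ChartedSpace (EuclideanSpace ℝ (Fin (d - 1))) S]
    (j : Fin (d + 1) → ℤ) (hj : StrictMono j)
    (U V : Fin (d + 1) → Set S)
    (hUopen : ∀ k, IsOpen (U k)) (hVopen : ∀ k, IsOpen (V k))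
    (hdisj : Pairwise fun k l => Disjoint (closure (U k)) (closure (U l)))
    (hUV : ∀ k, closure (U k) ⊆ V k)
    (hchart : ∀ k, ∃ g : (V k) → EuclideanSpace ℝ (Fin (d - 1)),
      Topology.IsOpenEmbedding g) :
    IsOpen {ψ : C(S, EuclideanSpace ℝ (Fin d)) |
        (⋂ k : Fin (d + 1), (f.toEquiv ^ (j k)) '' (⇑ψ '' closure (U k))) = ∅} ∧
    Dense {ψ : C(S, EuclideanSpace ℝ (Fin d)) |
        (⋂ k : Fin (d + 1), (f.toEquiv ^ (j k)) '' (⇑ψ '' closure (U k))) = ∅} := by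
  have : ∀ k, CompactSpace (closure (U k)) := fun k =>
    isCompact_iff_compactSpace.1 isClosed_closure.isCompact
  choose g hg using hchart
  choose h hh using fun k => f.exists_coe_eq_zpow (j k)
  let H : (∀ k, C(closure (U k), EuclideanSpace ℝ (Fin d))) ≃ₜ
      (∀ k, C(closure (U k), EuclideanSpace ℝ (Fin d))) :=
    .piCongrRight fun k => (Homeomorph.refl _).arrowCongr (h k)
  let T : C(S, EuclideanSpace ℝ (Fin d)) → ∀ k, C(closure (U k), EuclideanSpace ℝ (Fin d)) :=
    fun ψ => H fun k => ψ.restrict (closure (U k))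
  have hT : Continuous T := H.continuous.comp <|
    continuous_pi fun k => ContinuousMap.continuous_restrict _
  have hTopen : IsOpenMap T := H.isOpenMap.comp
    (ContinuousMap.isOpenMap_restrict_pi (fun _ => isClosed_closure) hdisj)
  have hset : {ψ : C(S, EuclideanSpace ℝ (Fin d)) |
      (⋂ k : Fin (d + 1), (f.toEquiv ^ (j k)) '' (⇑ψ '' closure (U k))) = ∅} =
      T ⁻¹' noCommonValue := by
    ext ψ
    simp only [Set.mem_ofPred_eq, Set.mem_preimage, noCommonValue, Set.eq_empty_iff_forall_notMem,
      Set.mem_iInter, ← hh, Set.image_image]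
    constructor
    · rintro hψ x ⟨y, hy⟩
      exact hψ y fun k => ⟨x k, (x k).2, hy k⟩
    · intro hψ y hy
      choose x hx hxy using hy
      exact hψ (fun k => ⟨x k, hx k⟩) ⟨y, hxy⟩
  rw [hset]
  refine ⟨isOpen_noCommonValue.preimage hT, (dense_noCommonValue
    (g := fun k x => g k (Set.inclusion (hUV k) x))
    (fun k => (hg k).isEmbedding.comp (.inclusion (hUV k))) ?_).preimage hTopen⟩
  obtain ⟨n, rfl⟩ := Nat.exists_eq_add_of_le' hd
  simp only [finrank_euclideanSpace_fin, Fintype.card_fin, Nat.add_sub_cancel]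
  linarith
end

section
/- Let f : K → K be a homeomorphism of a compact metric space K and let L ⊂ K be a compact set that is a zero probability set for f. Then for every ε>0 there exist an open set V ⊇ L and n₀ ∈ ℕ such that for every x ∈ K and every n ≥ n₀, (1/n) · #{j : 0 ≤ j ≤ n−1 and f^j(x) ∈ V} < ε. -/
open MeasureTheory Filter Topology

open scoped Classical

/-- The empirical measure `(1/n) ∑_{j<n} δ_{f^j x}` of an orbit segment. -/
noncomputable def empiricalMeasure {K : Type*} [MeasurableSpace K] (f : K → K) (n : ℕ) (x : K) :
    Measure K :=
  (n : ENNReal)⁻¹ • ∑ j ∈ Finset.range n, Measure.dirac (f^[j] x)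

lemma isProbabilityMeasure_empiricalMeasure {K : Type*} [MeasurableSpace K] (f : K → K) {n : ℕ}
    (hn : n ≠ 0) (x : K) : IsProbabilityMeasure (empiricalMeasure f n x) := by
  constructor
  simp [empiricalMeasure, ENNReal.inv_mul_cancel, hn]

lemma empiricalMeasure_apply {K : Type*} [MeasurableSpace K] (f : K → K) {n : ℕ} (hn : n ≠ 0)
    (x : K) {s : Set K} (hs : MeasurableSet s) :
    empiricalMeasure f n x s =
      ENNReal.ofReal
        ((Finset.filter (fun j => f^[j] x ∈ s) (Finset.range n)).card / (n : ℝ)) := by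
  have hn' : (0 : ℝ) < n := by positivity
  rw [ENNReal.ofReal_div_of_pos hn', ENNReal.ofReal_natCast, ENNReal.ofReal_natCast,
    ENNReal.div_eq_inv_mul]
  simp [empiricalMeasure, Measure.dirac_apply' _ hs, Set.indicator_apply]

lemma integral_empiricalMeasure {K : Type*} [TopologicalSpace K] [MeasurableSpace K]
    [OpensMeasurableSpace K] (f : K → K) (n : ℕ) (x : K) (g : BoundedContinuousFunction K ℝ) :
    ∫ y, g y ∂empiricalMeasure f n x = birkhoffAverage ℝ f g n x := by
  rw [empiricalMeasure, integral_smul_measure,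
    integral_finsetSum_measure fun _ _ => g.integrable _]
  simp [integral_dirac' _ _ g.continuous.stronglyMeasurable, birkhoffAverage, birkhoffSum]

/-- A weak limit of empirical measures of orbit segments whose lengths tend to infinity is
invariant. -/
lemma map_eq_of_tendsto_empiricalMeasure {K ι : Type*} [TopologicalSpace K]
    [HasOuterApproxClosed K] [MeasurableSpace K] [BorelSpace K] {f : K → K} (hf : Continuous f)
    {l : Filter ι} [l.NeBot] {n : ι → ℕ} (hn : Tendsto n l atTop) (x : ι → K)
    {μs : ι → ProbabilityMeasure K} (hμs : ∀ i, (μs i : Measure K) = empiricalMeasure f (n i) (x i))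
    {μ : ProbabilityMeasure K} (hμ : Tendsto μs l (𝓝 μ)) :
    Measure.map f (μ : Measure K) = μ := by
  refine ext_of_forall_integral_eq_of_IsFiniteMeasure fun g => ?_
  rw [integral_map hf.aemeasurable g.continuous.aestronglyMeasurable]
  rw [ProbabilityMeasure.tendsto_iff_forall_integral_tendsto] at hμ
  have hdiff := (hμ (g.compContinuous ⟨f, hf⟩)).sub (hμ g)
  simp only [hμs, integral_empiricalMeasure] at hdiff
  refine sub_eq_zero.mp (tendsto_nhds_unique hdiff ?_)
  have hbound : Tendsto (fun i => ((n i : ℝ))⁻¹ * (2 * ‖g‖)) l (𝓝 0) := by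
    simpa using (tendsto_inv_atTop_zero.comp
      (tendsto_natCast_atTop_atTop.comp hn)).mul_const (2 * ‖g‖)
  refine squeeze_zero_norm (fun i => ?_) hbound
  have hcomp : birkhoffAverage ℝ f (g.compContinuous ⟨f, hf⟩) (n i) (x i) =
      birkhoffAverage ℝ f g (n i) (f (x i)) := by
    simp [birkhoffAverage, birkhoffSum, (Function.Commute.iterate_self f _).eq]
  rw [hcomp, birkhoffAverage_apply_sub_birkhoffAverage, norm_smul, norm_inv, Real.norm_natCast,
    ← dist_eq_norm]
  gcongr
  exact g.dist_le_two_norm _ _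

/-- A compact zero-probability set has uniformly small visit frequency in some
neighborhood (lemma 5.2). -/
theorem stmt_10 {K : Type*} [MetricSpace K] [CompactSpace K]
    [MeasurableSpace K] [BorelSpace K]
    (f : K ≃ₜ K) (L : Set K) (hL : IsCompact L)
    (hzero : ∀ μ : Measure K, IsProbabilityMeasure μ → Measure.map (⇑f) μ = μ →
      μ L = 0)
    (ε : ℝ) (hε : 0 < ε) :
    ∃ (V : Set K) (n₀ : ℕ), IsOpen V ∧ L ⊆ V ∧
      ∀ (x : K) (n : ℕ), n₀ ≤ n →
        ((Finset.filter (fun j => (⇑f)^[j] x ∈ V) (Finset.range n)).card : ℝ) / n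
          < ε := by
  by_contra! hcon
  choose x n hn hfreq using fun k : ℕ => hcon (Metric.thickening (1 / ((k : ℝ) + 1)) L) (k + 1)
    Metric.isOpen_thickening (Metric.self_subset_thickening (by positivity) L)
  have hn0 : ∀ k, n k ≠ 0 := fun k => by have := hn k; omega
  have hntop : Tendsto n (hyperfilter ℕ : Filter ℕ) atTop :=
    (tendsto_atTop_mono (fun k => (Nat.le_succ k).trans (hn k)) tendsto_id).mono_left
      Nat.hyperfilter_le_atTop
  let μs : ℕ → ProbabilityMeasure K := fun k =>
    ⟨empiricalMeasure f (n k) (x k), isProbabilityMeasure_empiricalMeasure f (hn0 k) (x k)⟩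
  obtain ⟨μ, -, hμ⟩ := isCompact_univ.ultrafilter_le_nhds ((hyperfilter ℕ).map μs) (by simp)
  have hinv := map_eq_of_tendsto_empiricalMeasure f.continuous hntop x (fun _ => rfl) hμ
  have hthick : ∀ δ > 0, ENNReal.ofReal ε ≤ (μ : Measure K) (Metric.cthickening δ L) := by
    intro δ hδ
    refine le_trans (le_limsup_of_frequently_le (Eventually.frequently ?_))
      (ProbabilityMeasure.limsup_measure_closed_le_of_tendsto hμ Metric.isClosed_cthickening)
    have hsmall : ∀ᶠ k : ℕ in atTop, 1 / ((k : ℝ) + 1) < δ :=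
      tendsto_one_div_add_atTop_nhds_zero_nat.eventually (gt_mem_nhds hδ)
    filter_upwards [Nat.hyperfilter_le_atTop hsmall] with k hk
    calc ENNReal.ofReal ε
        ≤ empiricalMeasure f (n k) (x k) (Metric.thickening (1 / ((k : ℝ) + 1)) L) := by
          rw [empiricalMeasure_apply _ (hn0 k) _ Metric.isOpen_thickening.measurableSet]
          exact ENNReal.ofReal_le_ofReal (hfreq k)
      _ ≤ empiricalMeasure f (n k) (x k) (Metric.cthickening δ L) :=
          measure_mono ((Metric.thickening_mono hk.le L).trans
            (Metric.thickening_subset_cthickening δ L))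
  have hlim : Tendsto (fun δ => (μ : Measure K) (Metric.cthickening δ L)) (𝓝[>] 0)
      (𝓝 ((μ : Measure K) L)) :=
    (tendsto_measure_cthickening_of_isCompact hL).mono_left nhdsWithin_le_nhds
  have hle : ENNReal.ofReal ε ≤ (μ : Measure K) L :=
    ge_of_tendsto hlim (eventually_nhdsWithin_of_forall hthick)
  rw [hzero μ inferInstance hinv] at hle
  exact (ENNReal.ofReal_pos.mpr hε).not_ge hle
end

section
/- Let f : K → K be a homeomorphism of a compact metric space K. Then the set UH = {A ∈ C(K, SL(2,ℝ)) : (f,A) is uniformly hyperbolic} is open in C(K, SL(2,ℝ)) with the topology of uniform convergence. -/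
open MeasureTheory Filter Topology

section PlanarGeometry

/-- The action of `SL(2,ℝ)` on the euclidean plane. -/
noncomputable def sl2Act (M : Matrix.SpecialLinearGroup (Fin 2) ℝ)
    (v : EuclideanSpace ℝ (Fin 2)) : EuclideanSpace ℝ (Fin 2) :=
  Matrix.toEuclideanCLM (𝕜 := ℝ) (M : Matrix (Fin 2) (Fin 2) ℝ) v

/-- The standard area form on the euclidean plane. -/
def areaForm2 (v w : EuclideanSpace ℝ (Fin 2)) : ℝ := v 0 * w 1 - v 1 * w 0

lemma sl2Act_one (v : EuclideanSpace ℝ (Fin 2)) : sl2Act 1 v = v := by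
  simp [sl2Act]

lemma sl2Act_mul (M M' : Matrix.SpecialLinearGroup (Fin 2) ℝ)
    (v : EuclideanSpace ℝ (Fin 2)) : sl2Act (M * M') v = sl2Act M (sl2Act M' v) := by
  simp [sl2Act]

lemma sl2Act_smul (M : Matrix.SpecialLinearGroup (Fin 2) ℝ) (c : ℝ)
    (v : EuclideanSpace ℝ (Fin 2)) : sl2Act M (c • v) = c • sl2Act M v := by
  simp [sl2Act]

lemma sl2Act_apply (M : Matrix.SpecialLinearGroup (Fin 2) ℝ)
    (v : EuclideanSpace ℝ (Fin 2)) (i : Fin 2) :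
    sl2Act M v i = (M : Matrix (Fin 2) (Fin 2) ℝ) i 0 * v 0
      + (M : Matrix (Fin 2) (Fin 2) ℝ) i 1 * v 1 := by
  simp [sl2Act, Matrix.ofLp_toEuclideanCLM, Matrix.mulVec, dotProduct, Fin.sum_univ_two]

lemma norm_sl2Act_le (M : Matrix.SpecialLinearGroup (Fin 2) ℝ)
    (v : EuclideanSpace ℝ (Fin 2)) : ‖sl2Act M v‖ ≤ sl2Norm M * ‖v‖ :=
  ContinuousLinearMap.le_opNorm _ _

lemma sl2Norm_le_of_forall (M : Matrix.SpecialLinearGroup (Fin 2) ℝ) {B : ℝ} (hB : 0 ≤ B)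
    (h : ∀ w, ‖sl2Act M w‖ ≤ B * ‖w‖) : sl2Norm M ≤ B :=
  ContinuousLinearMap.opNorm_le_bound _ hB h

lemma norm_sq_fin_two (v : EuclideanSpace ℝ (Fin 2)) : ‖v‖ ^ 2 = v 0 ^ 2 + v 1 ^ 2 := by
  simp [EuclideanSpace.norm_sq_eq, Fin.sum_univ_two]

lemma inner_fin_two (v w : EuclideanSpace ℝ (Fin 2)) :
    inner ℝ v w = v 0 * w 0 + v 1 * w 1 := by
  simp [PiLp.inner_apply, Fin.sum_univ_two, mul_comm]

lemma areaForm2_sl2Act (M : Matrix.SpecialLinearGroup (Fin 2) ℝ)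
    (v w : EuclideanSpace ℝ (Fin 2)) :
    areaForm2 (sl2Act M v) (sl2Act M w) = areaForm2 v w := by
  have hdet := M.det_coe
  rw [Matrix.det_fin_two] at hdet
  simp only [areaForm2, sl2Act_apply]
  linear_combination (v 0 * w 1 - v 1 * w 0) * hdet

lemma inner_sq_add_areaForm2_sq (v w : EuclideanSpace ℝ (Fin 2)) :
    (inner ℝ v w) ^ 2 + areaForm2 v w ^ 2 = ‖v‖ ^ 2 * ‖w‖ ^ 2 := by
  rw [norm_sq_fin_two, norm_sq_fin_two, inner_fin_two, areaForm2]
  ring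

lemma abs_areaForm2_le (v w : EuclideanSpace ℝ (Fin 2)) :
    |areaForm2 v w| ≤ ‖v‖ * ‖w‖ := by
  apply abs_le_of_sq_le_sq _ (by positivity)
  nlinarith [inner_sq_add_areaForm2_sq v w, sq_nonneg (inner ℝ v w)]

lemma norm_mul_norm_le (v w : EuclideanSpace ℝ (Fin 2)) :
    ‖v‖ * ‖w‖ ≤ |inner ℝ v w| + |areaForm2 v w| := by
  apply le_of_sq_le_sq _ (by positivity)
  have h := inner_sq_add_areaForm2_sq v w
  rw [← sq_abs (inner ℝ v w), ← sq_abs (areaForm2 v w)] at h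
  nlinarith [mul_nonneg (abs_nonneg (inner ℝ v w)) (abs_nonneg (areaForm2 v w))]

/-- The quarter turn of the euclidean plane. -/
noncomputable def quarterTurn (v : EuclideanSpace ℝ (Fin 2)) : EuclideanSpace ℝ (Fin 2) :=
  !₂[-v 1, v 0]

lemma norm_quarterTurn (v : EuclideanSpace ℝ (Fin 2)) : ‖quarterTurn v‖ = ‖v‖ := by
  rw [← sq_eq_sq₀ (norm_nonneg _) (norm_nonneg _), norm_sq_fin_two, norm_sq_fin_two]
  simp [quarterTurn]
  ring

lemma areaForm2_quarterTurn (v : EuclideanSpace ℝ (Fin 2)) :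
    areaForm2 v (quarterTurn v) = ‖v‖ ^ 2 := by
  rw [norm_sq_fin_two]
  simp [quarterTurn, areaForm2]
  ring

/-- The inverse of a matrix in `SL(2,ℝ)` obeys the same norm bound as the matrix. -/
lemma norm_le_mul_norm_sl2Act {M : Matrix.SpecialLinearGroup (Fin 2) ℝ} {C : ℝ}
    (hC : sl2Norm M ≤ C) (v : EuclideanSpace ℝ (Fin 2)) : ‖v‖ ≤ C * ‖sl2Act M v‖ := by
  have hC0 : 0 ≤ C := (norm_nonneg _).trans hC
  rcases eq_or_ne v 0 with rfl | hv
  · simpa using mul_nonneg hC0 (norm_nonneg _)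
  have h := abs_areaForm2_le (sl2Act M v) (sl2Act M (quarterTurn v))
  rw [areaForm2_sl2Act, areaForm2_quarterTurn, abs_of_nonneg (by positivity)] at h
  have h2 := (norm_sl2Act_le M (quarterTurn v)).trans
    (mul_le_mul_of_nonneg_right hC (norm_nonneg _))
  rw [norm_quarterTurn] at h2
  have h3 := mul_le_mul_of_nonneg_left h2 (norm_nonneg (sl2Act M v))
  have hv' : 0 < ‖v‖ := norm_pos_iff.mpr hv
  refine le_of_mul_le_mul_right ?_ hv'
  nlinarith

lemma sl2Act_norm_pos (M : Matrix.SpecialLinearGroup (Fin 2) ℝ)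
    {v : EuclideanSpace ℝ (Fin 2)} (hv : v ≠ 0) : 0 < ‖sl2Act M v‖ := by
  have h := norm_le_mul_norm_sl2Act le_rfl (M := M) v
  have hv' : 0 < ‖v‖ := norm_pos_iff.mpr hv
  by_contra! h0
  have h1 : ‖sl2Act M v‖ = 0 := le_antisymm h0 (norm_nonneg _)
  rw [h1, mul_zero] at h
  linarith

lemma exists_norm_le_norm_sl2Act (M : Matrix.SpecialLinearGroup (Fin 2) ℝ) :
    ∃ v : EuclideanSpace ℝ (Fin 2), v ≠ 0 ∧ ‖v‖ ≤ ‖sl2Act M v‖ := by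
  set v : EuclideanSpace ℝ (Fin 2) := !₂[1, 0] with hvdef
  have hn : ‖v‖ = 1 := by
    rw [← sq_eq_sq₀ (norm_nonneg _) zero_le_one, norm_sq_fin_two]; simp [hvdef]
  have hv : v ≠ 0 := norm_pos_iff.mp (by rw [hn]; exact one_pos)
  by_cases h1 : ‖v‖ ≤ ‖sl2Act M v‖
  · exact ⟨v, hv, h1⟩
  · refine ⟨quarterTurn v, norm_pos_iff.mp (by rw [norm_quarterTurn, hn]; exact one_pos), ?_⟩
    have h := abs_areaForm2_le (sl2Act M v) (sl2Act M (quarterTurn v))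
    rw [areaForm2_sl2Act, areaForm2_quarterTurn, abs_of_nonneg (by positivity)] at h
    rw [norm_quarterTurn]
    rw [hn] at h h1 ⊢
    nlinarith [norm_nonneg (sl2Act M (quarterTurn v))]

/-- The component of `w` along `v`, measured in units of `v`, changes under `M` by at most a shear
term controlled by the area spanned by `v` and `w`. -/
lemma abs_inner_sl2Act_div_le {M : Matrix.SpecialLinearGroup (Fin 2) ℝ} {C : ℝ}
    (hC : sl2Norm M ≤ C) {v : EuclideanSpace ℝ (Fin 2)} (hv : v ≠ 0)
    (w : EuclideanSpace ℝ (Fin 2)) :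
    |inner ℝ (sl2Act M v) (sl2Act M w)| / ‖sl2Act M v‖ ^ 2 ≤
      |inner ℝ v w| / ‖v‖ ^ 2 + C * |areaForm2 v w| / (‖v‖ * ‖sl2Act M v‖) := by
  have hv0 : 0 < ‖v‖ := norm_pos_iff.mpr hv
  have hr := sl2Act_norm_pos M hv
  have key : inner ℝ (sl2Act M v) (sl2Act M w) * ‖v‖ ^ 2 =
      inner ℝ v w * ‖sl2Act M v‖ ^ 2
        + areaForm2 v w * inner ℝ (sl2Act M v) (sl2Act M (quarterTurn v)) := by
    simp only [norm_sq_fin_two, inner_fin_two, sl2Act_apply, areaForm2, quarterTurn]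
    simp
    ring
  have hin : |inner ℝ (sl2Act M v) (sl2Act M (quarterTurn v))| ≤ ‖sl2Act M v‖ * (C * ‖v‖) := by
    refine (abs_real_inner_le_norm _ _).trans (mul_le_mul_of_nonneg_left ?_ (norm_nonneg _))
    have h := (norm_sl2Act_le M (quarterTurn v)).trans
      (mul_le_mul_of_nonneg_right hC (norm_nonneg _))
    rwa [norm_quarterTurn] at h
  have habs : |inner ℝ (sl2Act M v) (sl2Act M w)| * ‖v‖ ^ 2 ≤
      |inner ℝ v w| * ‖sl2Act M v‖ ^ 2 + |areaForm2 v w| * (‖sl2Act M v‖ * (C * ‖v‖)) := by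
    calc _ = |inner ℝ (sl2Act M v) (sl2Act M w) * ‖v‖ ^ 2| := by
          rw [abs_mul, abs_of_pos (pow_pos hv0 2)]
      _ ≤ |inner ℝ v w * ‖sl2Act M v‖ ^ 2|
          + |areaForm2 v w * inner ℝ (sl2Act M v) (sl2Act M (quarterTurn v))| := by
          rw [key]; exact abs_add_le _ _
      _ ≤ _ := by
          rw [abs_mul, abs_mul, abs_of_pos (pow_pos hr 2)]
          gcongr
  rw [div_add_div _ _ (by positivity) (by positivity),
    div_le_div_iff₀ (by positivity) (by positivity)]
  have := mul_le_mul_of_nonneg_right habs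
    (by positivity : 0 ≤ ‖v‖ * ‖sl2Act M v‖)
  nlinarith

end PlanarGeometry

section Cocycle

variable {K : Type*} (f : K → K) (A : K → Matrix.SpecialLinearGroup (Fin 2) ℝ)

lemma cocycle_add (m n : ℕ) (x : K) :
    cocycle f A (m + n) x = cocycle f A m (f^[n] x) * cocycle f A n x := by
  induction n generalizing x with
  | zero => simp [cocycle]
  | succ n ih =>
    rw [← Nat.add_assoc]
    simp only [cocycle, ih, Function.iterate_succ_apply, mul_assoc]

lemma sl2Act_cocycle_add (m n : ℕ) (x : K) (v : EuclideanSpace ℝ (Fin 2)) :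
    sl2Act (cocycle f A (m + n) x) v =
      sl2Act (cocycle f A m (f^[n] x)) (sl2Act (cocycle f A n x) v) := by
  rw [cocycle_add, sl2Act_mul]

lemma sl2Act_cocycle_succ (n : ℕ) (x : K) (v : EuclideanSpace ℝ (Fin 2)) :
    sl2Act (cocycle f A (n + 1) x) v =
      sl2Act (A (f^[n] x)) (sl2Act (cocycle f A n x) v) := by
  rw [add_comm n 1, sl2Act_cocycle_add]
  simp [cocycle]

variable {f A} {C : ℝ}

/-- If the orbit of a vector stays above `η` up to time `n` while being at most `R * η` at both
ends, then the `n`-th iterate grows at most linearly. -/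
lemma sl2Norm_cocycle_le_of_valley (hC : ∀ x, sl2Norm (A x) ≤ C) {x : K}
    {v : EuclideanSpace ℝ (Fin 2)} {n : ℕ} {η R : ℝ} (hη : 0 < η) (hR : 0 ≤ R)
    (hlow : ∀ j ≤ n, η ≤ ‖sl2Act (cocycle f A j x) v‖)
    (h0 : ‖v‖ ≤ R * η) (hn : ‖sl2Act (cocycle f A n x) v‖ ≤ R * η) :
    sl2Norm (cocycle f A n x) ≤ 2 * R + n * (C * R ^ 2) := by
  have hC0 : 0 ≤ C := (norm_nonneg _).trans (hC x)
  have hvη : η ≤ ‖v‖ := by simpa [cocycle, sl2Act_one] using hlow 0 (Nat.zero_le _)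
  have hv0 : 0 < ‖v‖ := hη.trans_le hvη
  refine sl2Norm_le_of_forall _ (by positivity) fun w => ?_
  have hstep : ∀ j ≤ n, |inner ℝ (sl2Act (cocycle f A j x) v) (sl2Act (cocycle f A j x) w)|
      / ‖sl2Act (cocycle f A j x) v‖ ^ 2 ≤
      |inner ℝ v w| / ‖v‖ ^ 2 + j * (C * |areaForm2 v w| / η ^ 2) := by
    intro j
    induction j with
    | zero => intro _; simp [cocycle, sl2Act_one]
    | succ j ih =>
      intro hj
      have hr := hlow j (by omega)
      have hr' := hlow (j + 1) hj
      have h := abs_inner_sl2Act_div_le (hC (f^[j] x))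
        (norm_pos_iff.mp (hη.trans_le hr)) (sl2Act (cocycle f A j x) w)
      rw [areaForm2_sl2Act, ← sl2Act_cocycle_succ, ← sl2Act_cocycle_succ] at h
      have hden : C * |areaForm2 v w| /
          (‖sl2Act (cocycle f A j x) v‖ * ‖sl2Act (cocycle f A (j + 1) x) v‖) ≤
          C * |areaForm2 v w| / η ^ 2 := by
        apply div_le_div_of_nonneg_left (by positivity) (by positivity)
        rw [sq]
        gcongr
      have := ih (by omega)
      push_cast
      linarith
  have hn' := hlow n le_rfl
  have hlast := hstep n le_rfl
  have harea := norm_mul_norm_le (sl2Act (cocycle f A n x) v) (sl2Act (cocycle f A n x) w)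
  rw [areaForm2_sl2Act] at harea
  set r := ‖sl2Act (cocycle f A n x) v‖
  have hr0 : 0 < r := hη.trans_le hn'
  have hD := abs_areaForm2_le v w
  have hI := abs_real_inner_le_norm v w
  rw [div_le_iff₀ (by positivity)] at hlast
  have hw := norm_nonneg w
  have h1 : |inner ℝ v w| / ‖v‖ ^ 2 * r ≤ R * ‖w‖ := by
    calc _ ≤ ‖v‖ * ‖w‖ / ‖v‖ ^ 2 * (R * η) := by gcongr
      _ = R * ‖w‖ * (η / ‖v‖) := by field_simp
      _ ≤ R * ‖w‖ * 1 := by gcongr; exact (div_le_one hv0).mpr hvη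
      _ = _ := mul_one _
  have h2 : n * (C * |areaForm2 v w| / η ^ 2) * r ≤ n * (C * R ^ 2) * ‖w‖ := by
    calc _ ≤ n * (C * ((R * η) * ‖w‖) / η ^ 2) * (R * η) := by
          gcongr
          exact hD.trans (by gcongr)
      _ = _ := by field_simp
  have h3 : |areaForm2 v w| / r ≤ R * ‖w‖ := by
    rw [div_le_iff₀ hr0]
    calc |areaForm2 v w| ≤ R * η * ‖w‖ := hD.trans (by gcongr)
      _ ≤ R * r * ‖w‖ := by gcongr
      _ = _ := by ring
  have h4 : ‖sl2Act (cocycle f A n x) w‖ ≤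
      (|inner ℝ v w| / ‖v‖ ^ 2 + n * (C * |areaForm2 v w| / η ^ 2)) * r
        + |areaForm2 v w| / r := by
    refine le_of_mul_le_mul_left ?_ hr0
    have : r * (|areaForm2 v w| / r) = |areaForm2 v w| := by field_simp
    nlinarith
  linarith

end Cocycle

section Sequences

lemma le_pow_mul_of_step {r : ℕ → ℝ} {C : ℝ} (hC : 0 ≤ C) (hup : ∀ n, r (n + 1) ≤ C * r n)
    (n k : ℕ) : r (n + k) ≤ C ^ k * r n := by
  induction k with
  | zero => simp
  | succ k ih =>
    calc r (n + (k + 1)) ≤ C * r (n + k) := hup _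
      _ ≤ C * (C ^ k * r n) := by gcongr
      _ = _ := by ring

lemma le_pow_mul_of_step_back {r : ℕ → ℝ} {C : ℝ} (hC : 0 ≤ C)
    (hdown : ∀ n, r n ≤ C * r (n + 1)) (n k : ℕ) : r n ≤ C ^ k * r (n + k) := by
  induction k with
  | zero => simp
  | succ k ih =>
    calc r n ≤ C ^ k * r (n + k) := ih
      _ ≤ C ^ k * (C * r (n + k + 1)) := by gcongr; exact hdown _
      _ = _ := by rw [Nat.add_assoc]; ring

/-- A positive sequence with bounded ratios which, on `[0, 2N]`, is at most twice its value at `N`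
has either a valley of length at least `N₀` with sides of height `C`, or a flat piece of
length `N`. -/
lemma exists_valley {r : ℕ → ℝ} {C : ℝ} {N N₀ : ℕ} (hpos : ∀ n, 0 < r n) (hC : 1 ≤ C)
    (hup : ∀ n, r (n + 1) ≤ C * r n) (hdown : ∀ n, r n ≤ C * r (n + 1))
    (hmid : ∀ n ≤ 2 * N, r n ≤ 2 * r N) :
    ∃ p k : ℕ, ∃ η R : ℝ, 0 < η ∧ p + k ≤ 2 * N ∧ (∀ j ≤ k, η ≤ r (p + j)) ∧
      r p ≤ R * η ∧ r (p + k) ≤ R * η ∧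
      ((N₀ ≤ k ∧ R = C) ∨ (k = N ∧ R = 2 * C ^ N₀)) := by
  have hC0 : 0 < C := by linarith
  obtain ⟨q, hq, hqmin⟩ := Finset.exists_min_image (Finset.Icc N (2 * N)) r
    ⟨N, by simp; omega⟩
  obtain ⟨s, hs, hsmin⟩ := Finset.exists_min_image (Finset.Icc 0 N) r ⟨0, by simp⟩
  simp only [Finset.mem_Icc] at hq hqmin hs hsmin
  wlog hle : r s ≤ r q generalizing r q s
  · obtain ⟨p, k, η, R, hη, hpk, hlow, h1, h2, h3⟩ :=
      this (r := fun n => r (2 * N - n)) (fun n => hpos _)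
        (fun n => by
          rcases Nat.lt_or_ge n (2 * N) with h | h
          · have := hdown (2 * N - (n + 1))
            rwa [show 2 * N - (n + 1) + 1 = 2 * N - n by omega] at this
          · rw [show 2 * N - (n + 1) = 2 * N - n by omega]
            exact le_mul_of_one_le_left (hpos _).le hC)
        (fun n => by
          rcases Nat.lt_or_ge n (2 * N) with h | h
          · have := hup (2 * N - (n + 1))
            rwa [show 2 * N - (n + 1) + 1 = 2 * N - n by omega] at this
          · rw [show 2 * N - (n + 1) = 2 * N - n by omega]
            exact le_mul_of_one_le_left (hpos _).le hC)
        (fun n hn => by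
          simpa [show 2 * N - N = N by omega] using hmid (2 * N - n) (by omega))
        (q := 2 * N - s) (s := 2 * N - q) (hq := by omega) (hs := by omega)
        (hqmin := fun n hn => by
          simpa [show 2 * N - (2 * N - s) = s by omega] using hsmin (2 * N - n) (by omega))
        (hsmin := fun n hn => by
          simpa [show 2 * N - (2 * N - q) = q by omega] using hqmin (2 * N - n) (by omega))
        (hle := by
          simpa [show 2 * N - (2 * N - q) = q by omega,
            show 2 * N - (2 * N - s) = s by omega] using (not_le.mp hle).le)
    refine ⟨2 * N - (p + k), k, η, R, hη, by omega, fun j hj => ?_, h2, ?_, h3⟩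
    · have := hlow (k - j) (by omega)
      rwa [show 2 * N - (p + (k - j)) = 2 * N - (p + k) + j by omega] at this
    · rwa [show 2 * N - (p + k) + k = 2 * N - p by omega]
  set p := Nat.findGreatest (fun n => r n ≤ r q) N with hp
  have hpN : p ≤ N := Nat.findGreatest_le N
  have hpr : r p ≤ r q := Nat.findGreatest_spec (P := fun n => r n ≤ r q) hs.2 hle
  have hgt : ∀ j, p < j → j ≤ 2 * N → r q ≤ r j := by
    intro j hpj hj
    rcases Nat.lt_or_ge N j with h | h
    · exact hqmin j ⟨h.le, hj⟩
    · exact (not_le.mp (Nat.findGreatest_is_greatest (P := fun n => r n ≤ r q) hpj h)).le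
  have hpC : r q ≤ C * r p := by
    rcases hpN.eq_or_lt with h | h
    · rw [h]
      exact (hqmin N ⟨le_rfl, by omega⟩).trans (le_mul_of_one_le_left (hpos _).le hC)
    · exact (hgt (p + 1) (by omega) (by omega)).trans (hup p)
  rcases Nat.lt_or_ge (q - p) N₀ with hshort | hlong
  · have hq0 : r N ≤ C ^ N₀ * r q := by
      have := le_pow_mul_of_step_back hC0.le hdown N (q - N)
      rw [show N + (q - N) = q by omega] at this
      refine this.trans (mul_le_mul_of_nonneg_right ?_ (hpos q).le)
      exact pow_le_pow_right₀ hC (by omega)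
    refine ⟨N, N, r q, 2 * C ^ N₀, hpos q, by omega, fun j hj => hqmin _ ⟨by omega, by omega⟩,
      ?_, ?_, Or.inr ⟨rfl, rfl⟩⟩
    · linarith [hpos N]
    · linarith [hmid (N + N) (by omega)]
  · refine ⟨p, q - p, r q / C, C, div_pos (hpos q) hC0, by omega, fun j hj => ?_, ?_, ?_,
      Or.inl ⟨hlong, rfl⟩⟩
    · rw [div_le_iff₀ hC0, mul_comm]
      rcases Nat.eq_zero_or_pos j with rfl | hj0
      · simpa using hpC
      · exact (hgt (p + j) (by omega) (by omega)).trans (le_mul_of_one_le_left (hpos _).le hC)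
    · rwa [mul_div_cancel₀ _ hC0.ne']
    · rw [mul_div_cancel₀ _ hC0.ne', show p + (q - p) = q by omega]

variable {a : ℕ → ℝ} {C ρ : ℝ} {N : ℕ}

/-- A term dominating its left window is followed by exponential growth. -/
lemma growth_of_left_dominant (hpos : ∀ n, 0 < a n) (hC : 1 ≤ C)
    (hdown : ∀ n, a n ≤ C * a (n + 1)) (hρ : 1 ≤ ρ) (hρN : ρ ^ N ≤ 2)
    (hdouble : ∀ n, N ≤ n → ∃ j, n ≤ j + N ∧ j ≤ n + N ∧ 2 * a n < a j)
    (k n : ℕ) (hn : N ≤ n) (hdom : ∀ i, n ≤ i + N → i ≤ n → a i ≤ a n) :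
    ρ ^ k * a n ≤ (C * ρ) ^ N * a (n + k) := by
  induction k using Nat.strong_induction_on generalizing n with
  | _ k ih =>
  have hC0 : 0 < C := by linarith
  have hρ0 : 0 < ρ := by linarith
  rcases Nat.lt_or_ge k N with hk | hk
  · calc ρ ^ k * a n ≤ ρ ^ k * (C ^ k * a (n + k)) := by
          gcongr; exact le_pow_mul_of_step_back hC0.le hdown n k
      _ = (C * ρ) ^ k * a (n + k) := by rw [mul_pow]; ring
      _ ≤ _ := by
          have := (hpos (n + k)).le
          gcongr
          nlinarith
  · obtain ⟨j, hj, hjmax⟩ := Finset.exists_max_image (Finset.Icc (n - N) (n + N)) a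
      ⟨n, by simp⟩
    simp only [Finset.mem_Icc] at hj hjmax
    obtain ⟨i, hi1, hi2, hi⟩ := hdouble n hn
    have hij := hjmax i ⟨by omega, hi2⟩
    have hnj : n < j := by
      by_contra! h
      have := hdom j (by omega) h
      linarith [hpos n]
    have h := ih (k - (j - n)) (by omega) j (by omega)
      (fun i h1 h2 => hjmax i ⟨by omega, by omega⟩)
    rw [show j + (k - (j - n)) = n + k by omega] at h
    have hpow : ρ ^ (j - n) ≤ 2 := (pow_le_pow_right₀ hρ (by omega)).trans hρN
    calc ρ ^ k * a n = ρ ^ (k - (j - n)) * (ρ ^ (j - n) * a n) := by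
          rw [← mul_assoc, ← pow_add]; congr 2; omega
      _ ≤ ρ ^ (k - (j - n)) * a j := by
          gcongr
          nlinarith [hpos n]
      _ ≤ _ := h

/-- A term dominating its right window is preceded by exponential decay. -/
lemma decay_of_right_dominant (hpos : ∀ n, 0 < a n) (hC : 1 ≤ C)
    (hup : ∀ n, a (n + 1) ≤ C * a n) (hρ : 1 ≤ ρ) (hρN : ρ ^ N ≤ 2)
    (hdouble : ∀ n, N ≤ n → ∃ j, n ≤ j + N ∧ j ≤ n + N ∧ 2 * a n < a j)
    (n : ℕ) (hdom : ∀ i, n ≤ i → i ≤ n + N → a i ≤ a n) :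
    ρ ^ n * a n ≤ (C * ρ) ^ N * a 0 := by
  induction n using Nat.strong_induction_on with
  | _ n ih =>
  have hC0 : 0 < C := by linarith
  have hρ0 : 0 < ρ := by linarith
  rcases Nat.lt_or_ge n N with hk | hk
  · have h0 := le_pow_mul_of_step hC0.le hup 0 n
    rw [Nat.zero_add] at h0
    calc ρ ^ n * a n ≤ ρ ^ n * (C ^ n * a 0) := by gcongr
      _ = (C * ρ) ^ n * a 0 := by rw [mul_pow]; ring
      _ ≤ _ := by
          have := (hpos 0).le
          gcongr
          nlinarith
  · obtain ⟨j, hj, hjmax⟩ := Finset.exists_max_image (Finset.Icc (n - N) (n + N)) a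
      ⟨n, by simp⟩
    simp only [Finset.mem_Icc] at hj hjmax
    obtain ⟨i, hi1, hi2, hi⟩ := hdouble n hk
    have hij := hjmax i ⟨by omega, hi2⟩
    have hnj : j < n := by
      by_contra! h
      have := hdom j h (by omega)
      linarith [hpos n]
    have h := ih j hnj (fun i h1 h2 => hjmax i ⟨by omega, by omega⟩)
    have hpow : ρ ^ (n - j) ≤ 2 := (pow_le_pow_right₀ hρ (by omega)).trans hρN
    calc ρ ^ n * a n = ρ ^ j * (ρ ^ (n - j) * a n) := by
          rw [← mul_assoc, ← pow_add]; congr 2; omega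
      _ ≤ ρ ^ j * a j := by
          gcongr
          nlinarith [hpos n]
      _ ≤ _ := h

/-- If the sequence has not decreased between times `0` and `M`, with `M` large, then it grows
exponentially from time `M` on. -/
lemma growth_of_le (hpos : ∀ n, 0 < a n) (hC : 1 ≤ C)
    (hup : ∀ n, a (n + 1) ≤ C * a n) (hdown : ∀ n, a n ≤ C * a (n + 1))
    (hρ : 1 ≤ ρ) (hρN : ρ ^ N ≤ 2)
    (hdouble : ∀ n, N ≤ n → ∃ j, n ≤ j + N ∧ j ≤ n + N ∧ 2 * a n < a j)
    {M : ℕ} (hNM : N ≤ M) (hM : (C * ρ) ^ N ≤ ρ ^ (M - N)) (h0M : a 0 ≤ a M)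
    (k : ℕ) : ρ ^ k * a M ≤ (C * ρ) ^ N * a (M + (N + k)) := by
  have hρ0 : 0 < ρ := by linarith
  obtain ⟨j, hj, hjmax⟩ := Finset.exists_max_image (Finset.Icc (M - N) (M + N)) a
    ⟨M, by simp⟩
  simp only [Finset.mem_Icc] at hj hjmax
  obtain ⟨i, hi1, hi2, hi⟩ := hdouble M hNM
  have hij := hjmax i ⟨by omega, hi2⟩
  have hMj : M ≤ j := by
    by_contra! h
    have h1 := decay_of_right_dominant hpos hC hup hρ hρN hdouble j
      (fun i h1 h2 => hjmax i ⟨by omega, by omega⟩)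
    have h2 : (C * ρ) ^ N ≤ ρ ^ j := hM.trans (pow_le_pow_right₀ hρ (by omega))
    have h3 : 0 < ρ ^ j := by positivity
    have h4 : ρ ^ j * a j ≤ ρ ^ j * a 0 :=
      h1.trans (mul_le_mul_of_nonneg_right h2 (hpos 0).le)
    have h5 := le_of_mul_le_mul_left h4 h3
    linarith [hpos M]
  have h := growth_of_left_dominant hpos hC hdown hρ hρN hdouble (M + (N + k) - j) j (by omega)
    (fun i h1 h2 => hjmax i ⟨by omega, by omega⟩)
  rw [show j + (M + (N + k) - j) = M + (N + k) by omega] at h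
  refine le_trans ?_ h
  have := (hpos M).le
  gcongr
  · omega
  · linarith

end Sequences

section Hyperbolicity

/-- Every nonzero orbit segment of length `2 * N` at least doubles its middle norm somewhere. -/
def OrbitsDouble {K : Type*} (f : K → K) (A : K → Matrix.SpecialLinearGroup (Fin 2) ℝ)
    (N : ℕ) : Prop :=
  ∀ x : K, ∀ v : EuclideanSpace ℝ (Fin 2), v ≠ 0 →
    ∃ n ≤ 2 * N, 2 * ‖sl2Act (cocycle f A N x) v‖ < ‖sl2Act (cocycle f A n x) v‖

lemma exists_forall_linear_lt_exp (b c : ℝ) {ε : ℝ} (hε : 0 < ε) :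
    ∃ N₀ : ℕ, ∀ n ≥ N₀, b + n * c < Real.exp (ε * n) := by
  obtain ⟨N₀, hN₀⟩ := exists_nat_ge (2 * (|b| + |c|) / ε ^ 2 + 1)
  refine ⟨N₀, fun n hn => ?_⟩
  have hn' : 2 * (|b| + |c|) / ε ^ 2 + 1 ≤ n := hN₀.trans (by exact_mod_cast hn)
  have hnn : (0 : ℝ) ≤ 2 * (|b| + |c|) / ε ^ 2 := by positivity
  have hn1 : (1 : ℝ) ≤ n := by linarith
  have hquad := Real.quadratic_le_exp_of_nonneg (by positivity : 0 ≤ ε * n)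
  have h1 : 2 * (|b| + |c|) ≤ n * ε ^ 2 := by
    rw [← div_le_iff₀ (by positivity)]; linarith
  have h2 : 2 * (|b| + |c|) * n ≤ n * ε ^ 2 * n := by gcongr
  have h3 : |b| ≤ |b| * n := le_mul_of_one_le_right (abs_nonneg b) hn1
  have h4 : n * c ≤ n * |c| := by gcongr; exact le_abs_self c
  have h5 : 0 ≤ ε * n := by positivity
  nlinarith [le_abs_self b]

variable {K : Type*} {f : K → K} {A : K → Matrix.SpecialLinearGroup (Fin 2) ℝ} {C : ℝ}

lemma norm_sl2Act_cocycle_succ_le (hC : ∀ x, sl2Norm (A x) ≤ C) (x : K)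
    (v : EuclideanSpace ℝ (Fin 2)) (n : ℕ) :
    ‖sl2Act (cocycle f A (n + 1) x) v‖ ≤ C * ‖sl2Act (cocycle f A n x) v‖ := by
  rw [sl2Act_cocycle_succ]
  exact (norm_sl2Act_le _ _).trans (mul_le_mul_of_nonneg_right (hC _) (norm_nonneg _))

lemma norm_sl2Act_cocycle_le_succ (hC : ∀ x, sl2Norm (A x) ≤ C) (x : K)
    (v : EuclideanSpace ℝ (Fin 2)) (n : ℕ) :
    ‖sl2Act (cocycle f A n x) v‖ ≤ C * ‖sl2Act (cocycle f A (n + 1) x) v‖ := by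
  rw [sl2Act_cocycle_succ]
  exact norm_le_mul_norm_sl2Act (hC _) _

lemma UnifHyp.exists_orbitsDouble (hC1 : 1 ≤ C) (hC : ∀ x, sl2Norm (A x) ≤ C)
    (h : UnifHyp f A) : ∃ N, OrbitsDouble f A N := by
  obtain ⟨ε, hε, N₁, hgrow⟩ := h
  obtain ⟨N₂, hN₂⟩ := exists_forall_linear_lt_exp (2 * C) (C * C ^ 2) hε
  set N₀ := max N₁ N₂
  set R := 2 * C ^ N₀
  obtain ⟨N₃, hN₃⟩ := exists_forall_linear_lt_exp (2 * R) (C * R ^ 2) hε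
  refine ⟨max N₁ N₃, fun x v hv => ?_⟩
  set N := max N₁ N₃
  by_contra! hmid
  obtain ⟨p, k, η, S, hη, -, hlow, hp, hpk, hS⟩ :=
    exists_valley (r := fun n => ‖sl2Act (cocycle f A n x) v‖) (N₀ := N₀)
      (fun n => sl2Act_norm_pos _ hv) hC1 (norm_sl2Act_cocycle_succ_le hC x v)
      (norm_sl2Act_cocycle_le_succ hC x v) hmid
  simp only [add_comm p, sl2Act_cocycle_add] at hlow hpk
  have hS0 : 0 ≤ S := by
    rcases hS with ⟨-, rfl⟩ | ⟨-, rfl⟩ <;> positivity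
  have hle := sl2Norm_cocycle_le_of_valley hC hη hS0 hlow hp hpk
  rcases hS with ⟨hk, rfl⟩ | ⟨rfl, rfl⟩
  · have h1 := hgrow (f^[p] x) k ((le_max_left _ _).trans hk)
    have h2 := hN₂ k ((le_max_right _ _).trans hk)
    linarith
  · have h1 := hgrow (f^[p] x) N (le_max_left _ _)
    have h2 := hN₃ N (le_max_right _ _)
    linarith

lemma OrbitsDouble.unifHyp (hf : Function.Surjective f) (hC1 : 1 ≤ C)
    (hC : ∀ x, sl2Norm (A x) ≤ C) {N : ℕ} (h : OrbitsDouble f A N) : UnifHyp f A := by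
  set δ := Real.log 2 / (N + 1) with hδ
  have hlog : 0 < Real.log 2 := Real.log_pos one_lt_two
  have hδ0 : 0 < δ := by positivity
  have hρ : 1 < Real.exp δ := Real.one_lt_exp_iff.mpr hδ0
  have hρN : Real.exp δ ^ N ≤ 2 := by
    rw [← Real.exp_nat_mul, ← Real.le_log_iff_exp_le two_pos, hδ, mul_div_assoc',
      div_le_iff₀ (by positivity)]
    nlinarith
  obtain ⟨m, hm⟩ := pow_unbounded_of_one_lt ((C * Real.exp δ) ^ N) hρ
  have hD0 : 0 < (C * Real.exp δ) ^ N := by positivity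
  have hgrow : ∀ x k, Real.exp δ ^ k ≤
      (C * Real.exp δ) ^ N * sl2Norm (cocycle f A (N + k) x) := by
    intro x k
    obtain ⟨y, rfl⟩ := hf.iterate (N + m) x
    obtain ⟨v, hv, hv'⟩ := exists_norm_le_norm_sl2Act (cocycle f A (N + m) y)
    have hpos : ∀ n, 0 < ‖sl2Act (cocycle f A n y) v‖ := fun n => sl2Act_norm_pos _ hv
    have hg := growth_of_le (a := fun n => ‖sl2Act (cocycle f A n y) v‖) (M := N + m)
      hpos hC1 (norm_sl2Act_cocycle_succ_le hC y v)
      (norm_sl2Act_cocycle_le_succ hC y v) hρ.le hρN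
      (fun n hn => by
        obtain ⟨j, hj, hlt⟩ := h (f^[n - N] y) (sl2Act (cocycle f A (n - N) y) v)
          (norm_pos_iff.mp (hpos _))
        rw [← sl2Act_cocycle_add, ← sl2Act_cocycle_add, Nat.add_sub_cancel' hn] at hlt
        exact ⟨j + (n - N), by omega, by omega, hlt⟩)
      (Nat.le_add_right _ _) (by rw [Nat.add_sub_cancel_left]; exact hm.le)
      (by simpa [cocycle, sl2Act_one] using hv') k
    simp only [add_comm (N + m) (N + k)] at hg
    rw [sl2Act_cocycle_add f A (N + k) (N + m)] at hg
    refine le_of_mul_le_mul_right (hg.trans ?_) (hpos (N + m))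
    rw [mul_assoc]
    exact mul_le_mul_of_nonneg_left (norm_sl2Act_le _ _) hD0.le
  obtain ⟨k₀, hk₀⟩ := pow_unbounded_of_one_lt
    ((C * Real.exp δ) ^ N * Real.exp (δ / 2 * N)) (Real.one_lt_exp_iff.mpr (half_pos hδ0))
  refine ⟨δ / 2, half_pos hδ0, N + k₀, fun x n hn => ?_⟩
  obtain ⟨k, rfl⟩ := Nat.exists_eq_add_of_le ((Nat.le_add_right N k₀).trans hn)
  have hk : (C * Real.exp δ) ^ N * Real.exp (δ / 2 * N) ≤ Real.exp (δ / 2) ^ k :=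
    hk₀.le.trans (pow_le_pow_right₀ (Real.one_lt_exp_iff.mpr (half_pos hδ0)).le (by omega))
  refine le_of_mul_le_mul_left (le_trans ?_ (hgrow x k)) hD0
  calc (C * Real.exp δ) ^ N * Real.exp (δ / 2 * ((N + k : ℕ) : ℝ))
      = (C * Real.exp δ) ^ N * Real.exp (δ / 2 * N) * Real.exp (δ / 2) ^ k := by
        rw [Nat.cast_add, mul_add, Real.exp_add, ← Real.exp_nat_mul, mul_comm (k : ℝ), mul_assoc]
    _ ≤ Real.exp (δ / 2) ^ k * Real.exp (δ / 2) ^ k := by gcongr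
    _ = Real.exp δ ^ k := by rw [← mul_pow, ← Real.exp_add, add_halves]

end Hyperbolicity

section Openness

variable {K : Type*} [TopologicalSpace K]

lemma continuous_sl2Norm : Continuous sl2Norm := by
  have h : Continuous fun M : Matrix (Fin 2) (Fin 2) ℝ => Matrix.toEuclideanCLM (𝕜 := ℝ) M :=
    LinearMap.continuous_of_finiteDimensional
      (Matrix.toEuclideanCLM (n := Fin 2) (𝕜 := ℝ)).toAlgEquiv.toLinearMap
  exact (h.comp continuous_induced_dom).norm

lemma exists_sl2Norm_bound [CompactSpace K] (A : C(K, Matrix.SpecialLinearGroup (Fin 2) ℝ)) :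
    ∃ C : ℝ, 1 ≤ C ∧ ∀ x, sl2Norm (A x) ≤ C := by
  obtain ⟨C, hC⟩ := (isCompact_range (continuous_sl2Norm.comp A.continuous)).bddAbove
  exact ⟨max 1 C, le_max_left _ _, fun x => (hC ⟨x, rfl⟩).trans (le_max_right _ _)⟩

lemma continuous_cocycle [LocallyCompactSpace K] {f : K → K} (hf : Continuous f) (n : ℕ) :
    Continuous fun p : C(K, Matrix.SpecialLinearGroup (Fin 2) ℝ) × K =>
      (cocycle f p.1 n p.2 : Matrix (Fin 2) (Fin 2) ℝ) := by
  induction n with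
  | zero => simpa [cocycle] using continuous_const
  | succ n ih =>
    simp only [cocycle, Matrix.SpecialLinearGroup.coe_mul]
    refine Continuous.matrix_mul (ih.comp (continuous_fst.prodMk (hf.comp continuous_snd))) ?_
    exact continuous_induced_dom.comp (continuous_fst.eval continuous_snd)

lemma continuous_norm_sl2Act_cocycle [LocallyCompactSpace K] {f : K → K} (hf : Continuous f)
    (n : ℕ) :
    Continuous fun p : (K × Metric.sphere (0 : EuclideanSpace ℝ (Fin 2)) 1) ×
        C(K, Matrix.SpecialLinearGroup (Fin 2) ℝ) =>
      ‖sl2Act (cocycle f p.2 n p.1.1) p.1.2‖ := by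
  have hM : Continuous fun p : (K × Metric.sphere (0 : EuclideanSpace ℝ (Fin 2)) 1) ×
        C(K, Matrix.SpecialLinearGroup (Fin 2) ℝ) =>
      (cocycle f p.2 n p.1.1 : Matrix (Fin 2) (Fin 2) ℝ) :=
    (continuous_cocycle hf n).comp
      (continuous_snd.prodMk (continuous_fst.comp continuous_fst))
  have hcoord : ∀ i : Fin 2, Continuous
      fun p : (K × Metric.sphere (0 : EuclideanSpace ℝ (Fin 2)) 1) ×
        C(K, Matrix.SpecialLinearGroup (Fin 2) ℝ) =>
      (p.1.2 : EuclideanSpace ℝ (Fin 2)) i := fun i => by fun_prop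
  have hnorm : ∀ w : EuclideanSpace ℝ (Fin 2), ‖w‖ = √(w 0 ^ 2 + w 1 ^ 2) := fun w => by
    rw [← norm_sq_fin_two, Real.sqrt_sq (norm_nonneg w)]
  simp only [hnorm, sl2Act_apply]
  have hentry := fun i j => hM.matrix_elem i j
  have h0 := hcoord 0
  have h1 := hcoord 1
  exact (((((hentry 0 0).mul h0).add ((hentry 0 1).mul h1)).pow 2).add
    ((((hentry 1 0).mul h0).add ((hentry 1 1).mul h1)).pow 2)).sqrt

lemma orbitsDouble_iff_sphere {K : Type*} {f : K → K}
    {A : K → Matrix.SpecialLinearGroup (Fin 2) ℝ} {N : ℕ} :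
    OrbitsDouble f A N ↔ ∀ p : K × Metric.sphere (0 : EuclideanSpace ℝ (Fin 2)) 1,
      ∃ n ≤ 2 * N, 2 * ‖sl2Act (cocycle f A N p.1) p.2‖ < ‖sl2Act (cocycle f A n p.1) p.2‖ := by
  refine ⟨fun h p => h p.1 p.2 (ne_zero_of_mem_unit_sphere p.2), fun h x v hv => ?_⟩
  have hv0 : 0 < ‖v‖ := norm_pos_iff.mpr hv
  obtain ⟨n, hn, hlt⟩ := h (x, ⟨‖v‖⁻¹ • v, by simp [norm_smul, hv0.ne']⟩)
  refine ⟨n, hn, ?_⟩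
  simp only [sl2Act_smul, norm_smul, norm_inv, norm_norm] at hlt
  refine lt_of_mul_lt_mul_left ?_ (inv_nonneg.mpr hv0.le)
  linarith

lemma isOpen_orbitsDouble [CompactSpace K] [LocallyCompactSpace K] {f : K → K}
    (hf : Continuous f) (N : ℕ) :
    IsOpen {A : C(K, Matrix.SpecialLinearGroup (Fin 2) ℝ) | OrbitsDouble f A N} := by
  set U : Set ((K × Metric.sphere (0 : EuclideanSpace ℝ (Fin 2)) 1) ×
      C(K, Matrix.SpecialLinearGroup (Fin 2) ℝ)) :=
    ⋃ n ∈ {n | n ≤ 2 * N}, {p | 2 * ‖sl2Act (cocycle f p.2 N p.1.1) p.1.2‖ <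
      ‖sl2Act (cocycle f p.2 n p.1.1) p.1.2‖} with hU
  have hUo : IsOpen U := isOpen_biUnion fun n _ =>
    isOpen_lt (continuous_const.mul (continuous_norm_sl2Act_cocycle hf N))
      (continuous_norm_sl2Act_cocycle hf n)
  have hclosed := isClosedMap_snd_of_compactSpace _ hUo.isClosed_compl
  convert hclosed.isOpen_compl using 1
  ext A
  simp [orbitsDouble_iff_sphere, hU]

end Openness

/-- The set of uniformly hyperbolic cocycles is open. -/
theorem stmt_11 {K : Type*} [MetricSpace K] [CompactSpace K] (f : K ≃ₜ K) :
    IsOpen {A : C(K, Matrix.SpecialLinearGroup (Fin 2) ℝ) | UnifHyp (⇑f) (⇑A)} := by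
  have hset : {A : C(K, Matrix.SpecialLinearGroup (Fin 2) ℝ) | UnifHyp (⇑f) (⇑A)} =
      ⋃ N, {A : C(K, Matrix.SpecialLinearGroup (Fin 2) ℝ) | OrbitsDouble f A N} := by
    ext A
    obtain ⟨C, hC1, hC⟩ := exists_sl2Norm_bound A
    rw [Set.mem_iUnion]
    exact ⟨fun h => h.exists_orbitsDouble hC1 hC, fun ⟨_, h⟩ => h.unifHyp f.surjective hC1 hC⟩
  rw [hset]
  exact isOpen_iUnion fun N => isOpen_orbitsDouble f.continuous N
end

section
/- Let f : K → K be a homeomorphism of a compact metric space K, let X ⊂ K be a Borel set, and let m ∈ ℕ. Suppose that for every x ∈ K the set {ℓ ∈ ℤ : f^ℓ(x) ∈ X} has cardinality at most m. Then X is a zero probability set for f, i.e. μ(X) = 0 for every f-invariant Borel probability measure μ on K. -/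
open MeasureTheory Filter Topology

/-- A Borel set visited at most m times by every full orbit has zero measure for
every invariant probability. -/
theorem stmt_13 {K : Type*} [MetricSpace K] [CompactSpace K]
    [MeasurableSpace K] [BorelSpace K]
    (f : K ≃ₜ K) (X : Set K) (hX : MeasurableSet X) (m : ℕ)
    (h : ∀ x : K, Set.encard {ℓ : ℤ | (f.toEquiv ^ ℓ) x ∈ X} ≤ (m : ℕ∞)) :
    ∀ μ : Measure K, IsProbabilityMeasure μ → Measure.map (⇑f) μ = μ → μ X = 0 := by
  intro μ _ hμ
  have hf : MeasurePreserving f μ μ := ⟨f.continuous.measurable, hμ⟩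
  have hrec := hf.conservative.ae_mem_imp_frequently_image_mem hX.nullMeasurableSet
  refine measure_eq_zero_iff_ae_notMem.2 (hrec.mono fun x hx hxX => ?_)
  have hfin : {ℓ : ℤ | (f.toEquiv ^ ℓ) x ∈ X}.Finite :=
    Set.finite_of_encard_le_coe (h x)
  refine Nat.frequently_atTop_iff_infinite.1 (hx hxX)
    ((hfin.preimage (Nat.cast_injective (R := ℤ)).injOn).subset fun n hn => ?_)
  have hpow : (f.toEquiv ^ (n : ℤ)) x = f^[n] x := by
    rw [zpow_natCast]
    exact congrFun (Equiv.Perm.iterate_eq_pow f.toEquiv n).symm x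
  change (f.toEquiv ^ (n : ℤ)) x ∈ X
  rw [hpow]
  exact hn
end

section
/- Let f : K → K be a homeomorphism of a compact metric space K and let U ⊂ K be an open set whose boundary ∂U is a zero probability set for f. For n ≥ 1, let U_n = U ∩ f^{-n}(U) \ ⋃_{j=1}^{n−1} f^{-j}(U) be the set of points of U whose first return time to U equals n. Then for every n ≥ 1, the boundary ∂U_n is a zero probability set for f. -/
open MeasureTheory Filter Topology

/-- The frontier of a finite union is null as soon as all the frontiers are. -/
theorem measure_frontier_biUnion_finset_eq_zero {X ι : Type*} [TopologicalSpace X]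
    [MeasurableSpace X] {μ : Measure X} (I : Finset ι) {s : ι → Set X}
    (hs : ∀ i ∈ I, μ (frontier (s i)) = 0) : μ (frontier (⋃ i ∈ I, s i)) = 0 := by
  classical
  induction I using Finset.induction_on with
  | empty => simp
  | insert a I _ ih =>
    rw [Finset.set_biUnion_insert, ← frontier_compl, Set.compl_union]
    refine null_frontier_inter ?_ ?_
    · rw [frontier_compl]
      exact hs a (Finset.mem_insert_self a I)
    · rw [frontier_compl]
      exact ih fun i hi => hs i (Finset.mem_insert_of_mem hi)

/-- Iterates of a measure-preserving homeomorphism pull sets with null frontier back to sets with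
null frontier. -/
theorem measure_frontier_preimage_iterate_eq_zero {X : Type*} [TopologicalSpace X]
    [MeasurableSpace X] [BorelSpace X] {μ : Measure X} {f : X ≃ₜ X}
    (hf : MeasurePreserving f μ μ) {s : Set X} (hs : μ (frontier s) = 0) (n : ℕ) :
    μ (frontier (f^[n] ⁻¹' s)) = 0 := by
  induction n with
  | zero => simpa using hs
  | succ n ih =>
    rw [Function.iterate_succ, Set.preimage_comp, ← f.preimage_frontier,
      hf.measure_preimage isClosed_frontier.nullMeasurableSet]
    exact ih

/-- If ∂U has zero probability then so does the boundary of each first-return-time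
level set U_n. -/
theorem stmt_16 {K : Type*} [MetricSpace K] [CompactSpace K]
    [MeasurableSpace K] [BorelSpace K]
    (f : K ≃ₜ K) (U : Set K) (hU : IsOpen U)
    (hbd : ∀ μ : Measure K, IsProbabilityMeasure μ → Measure.map (⇑f) μ = μ →
      μ (frontier U) = 0)
    (n : ℕ) (hn : 1 ≤ n) :
    ∀ μ : Measure K, IsProbabilityMeasure μ → Measure.map (⇑f) μ = μ →
      μ (frontier ((U ∩ (⇑f)^[n] ⁻¹' U) \ ⋃ j ∈ Finset.Ico 1 n, (⇑f)^[j] ⁻¹' U)) = 0 := by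
  intro μ hμ hinv
  have hf : MeasurePreserving f μ μ := ⟨f.measurable, hinv⟩
  have hpre := measure_frontier_preimage_iterate_eq_zero hf (hbd μ hμ hinv)
  rw [Set.sdiff_eq]
  refine null_frontier_inter
    (null_frontier_inter (hpre 0) (hpre n)) ?_
  rw [frontier_compl]
  exact measure_frontier_biUnion_finset_eq_zero _ fun j _ => hpre j
end
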